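/- Let A and B be commutative rings which are integral domains, finitely generated ℂ-algebras, smooth over ℂ (i.e. Algebra.Smooth ℂ A and Algebra.Smooth ℂ B hold), and of Krull dimension 1. If the ℂ-algebras A ⊗_ℂ A and B ⊗_ℂ B are isomorphic, then the ℂ-algebras A and B are isomorphic. -/

import Mathlib

open TensorProduct

section LaurentOrder

/-- Prefer the coefficientwise algebra structure over the one through power series. -/
noncomputable instance hahnSeriesIntAlgebra {k Ω : Type} [Field k] [Field Ω] [Algebra k Ω] :
    Algebra k (HahnSeries ℤ Ω) := HahnSeries.instAlgebra

lemma le_orderTop_add {Ω : Type} [Field Ω] {N : WithTop ℤ} {x y : HahnSeries ℤ Ω}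
    (hx : N ≤ x.orderTop) (hy : N ≤ y.orderTop) : N ≤ (x + y).orderTop :=
  (le_min hx hy).trans HahnSeries.min_orderTop_le_orderTop_add

lemma le_orderTop_sub {Ω : Type} [Field Ω] {N : WithTop ℤ} {x y : HahnSeries ℤ Ω}
    (hx : N ≤ x.orderTop) (hy : N ≤ y.orderTop) : N ≤ (x - y).orderTop :=
  (le_min hx hy).trans HahnSeries.min_orderTop_le_orderTop_sub

lemma exists_int_le_orderTop {Ω : Type} [Field Ω] (x : HahnSeries ℤ Ω) :
    ∃ N : ℤ, (N : WithTop ℤ) ≤ x.orderTop := by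
  by_cases h : x.orderTop = ⊤
  · exact ⟨0, by rw [h]; exact le_top⟩
  · obtain ⟨n, hn⟩ := WithTop.ne_top_iff_exists.mp h
    exact ⟨n, hn.le⟩

lemma exists_int_eq_orderTop {Ω : Type} [Field Ω] {x : HahnSeries ℤ Ω} (hx : x ≠ 0) :
    ∃ N : ℤ, x.orderTop = (N : WithTop ℤ) := by
  obtain ⟨n, hn⟩ := WithTop.ne_top_iff_exists.mp (HahnSeries.orderTop_ne_top.mpr hx)
  exact ⟨n, hn.symm⟩

lemma coeff_zero_mul_of_nonneg {Ω : Type} [Field Ω] {x y : HahnSeries ℤ Ω}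
    (hx : 0 ≤ x.orderTop) (hy : 0 ≤ y.orderTop) :
    (x * y).coeff 0 = x.coeff 0 * y.coeff 0 := by
  obtain ⟨p, rfl⟩ : ∃ p : PowerSeries Ω, (p : LaurentSeries Ω) = x := by
    refine ⟨PowerSeries.mk fun n => x.coeff n, ?_⟩
    ext n
    rcases lt_or_ge n 0 with h | h
    · rw [HahnSeries.coeff_eq_zero_of_lt_orderTop (lt_of_lt_of_le (by exact_mod_cast h) hx)]
      simp [PowerSeries.coeff_coe, h]
    · lift n to ℕ using h
      simp
  obtain ⟨q, rfl⟩ : ∃ p : PowerSeries Ω, (p : LaurentSeries Ω) = y := by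
    refine ⟨PowerSeries.mk fun n => y.coeff n, ?_⟩
    ext n
    rcases lt_or_ge n 0 with h | h
    · rw [HahnSeries.coeff_eq_zero_of_lt_orderTop (lt_of_lt_of_le (by exact_mod_cast h) hy)]
      simp [PowerSeries.coeff_coe, h]
    · lift n to ℕ using h
      simp
  have h (p : PowerSeries Ω) : ((p : LaurentSeries Ω)).coeff 0 = PowerSeries.constantCoeff p := by
    simp [PowerSeries.coeff_coe]
  rw [← PowerSeries.coe_mul, h, h, h, map_mul]

lemma orderTop_pow' {Ω : Type} [Field Ω] (x : HahnSeries ℤ Ω) (n : ℕ) :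
    (x ^ n).orderTop = n • x.orderTop := by
  induction n with
  | zero => simp
  | succ n ih => rw [pow_succ, HahnSeries.orderTop_mul, ih, succ_nsmul]

lemma orderTop_zpow_int {Ω : Type} [Field Ω] {x : HahnSeries ℤ Ω} {q : ℤ}
    (hx : x.orderTop = (q : WithTop ℤ)) (n : ℤ) :
    (x ^ n).orderTop = ((n * q : ℤ) : WithTop ℤ) := by
  have hx0 : x ≠ 0 := by rintro rfl; simp at hx
  have hnat : ∀ n : ℕ, (x ^ n).orderTop = ((n * q : ℤ) : WithTop ℤ) := by
    intro n
    rw [orderTop_pow', hx, ← WithTop.coe_nsmul]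
    simp
  rcases n.eq_nat_or_neg with ⟨m, rfl | rfl⟩
  · rw [zpow_natCast, hnat]
  · have h1 : (x ^ (-(m : ℤ)) * x ^ m).orderTop = 0 := by
      rw [zpow_neg, zpow_natCast, inv_mul_cancel₀ (pow_ne_zero _ hx0), HahnSeries.orderTop_one]
    rw [HahnSeries.orderTop_mul, hnat] at h1
    obtain ⟨N, hN⟩ := exists_int_eq_orderTop (zpow_ne_zero (-(m : ℤ)) hx0)
    rw [hN] at h1 ⊢
    norm_cast at h1 ⊢
    linarith

lemma orderTop_algebraMap_of_ne_zero {k Ω : Type} [Field k] [Field Ω] [Algebra k Ω] {c : k}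
    (hc : c ≠ 0) : (algebraMap k (HahnSeries ℤ Ω) c).orderTop = 0 := by
  rw [HahnSeries.algebraMap_apply, HahnSeries.C_apply, HahnSeries.orderTop_single]
  · rfl
  · simpa using hc

lemma orderTop_algebraMap_nonneg {k Ω : Type} [Field k] [Field Ω] [Algebra k Ω] (c : k) :
    0 ≤ (algebraMap k (HahnSeries ℤ Ω) c).orderTop := by
  by_cases hc : c = 0
  · simp [hc]
  · exact (orderTop_algebraMap_of_ne_zero hc).ge

lemma coeff_zero_algebraMap {k Ω : Type} [Field k] [Field Ω] [Algebra k Ω] (c : k) :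
    (algebraMap k (HahnSeries ℤ Ω) c).coeff 0 = algebraMap k Ω c := by
  rw [HahnSeries.algebraMap_apply, HahnSeries.C_apply, HahnSeries.coeff_single_same]

/-- The closure of a subalgebra of a field of Laurent series for the order topology. -/
def orderClosure {k Ω : Type} [Field k] [Field Ω] [Algebra k Ω]
    (R : Subalgebra k (HahnSeries ℤ Ω)) : Subalgebra k (HahnSeries ℤ Ω) where
  carrier := {z | ∀ N : ℤ, ∃ w ∈ R, (N : WithTop ℤ) ≤ (z - w).orderTop}
  mul_mem' := by
    intro z z' hz hz' N
    obtain ⟨L, hL⟩ := exists_int_le_orderTop z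
    obtain ⟨L', hL'⟩ := exists_int_le_orderTop z'
    obtain ⟨w', hw', h'⟩ := hz' (max (N - L) L')
    obtain ⟨w, hw, h⟩ := hz (N - L')
    refine ⟨w * w', mul_mem hw hw', ?_⟩
    have e : z * z' - w * w' = z * (z' - w') + (z - w) * w' := by ring
    rw [e]
    have hw'L : (L' : WithTop ℤ) ≤ w'.orderTop := by
      have : w' = z' - (z' - w') := by ring
      rw [this]
      exact le_orderTop_sub hL' (le_trans (by exact_mod_cast le_max_right _ _) h')
    apply le_orderTop_add
    · rw [HahnSeries.orderTop_mul]
      refine le_trans ?_ (add_le_add hL h')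
      norm_cast
      have := le_max_left (N - L) L'
      omega
    · rw [HahnSeries.orderTop_mul]
      refine le_trans ?_ (add_le_add h hw'L)
      norm_cast
      omega
  add_mem' := by
    intro z z' hz hz' N
    obtain ⟨w, hw, h⟩ := hz N
    obtain ⟨w', hw', h'⟩ := hz' N
    refine ⟨w + w', add_mem hw hw', ?_⟩
    rw [add_sub_add_comm]
    exact le_orderTop_add h h'
  algebraMap_mem' := fun r N => ⟨algebraMap _ _ r, R.algebraMap_mem r, by simp⟩

lemma le_orderClosure {k Ω : Type} [Field k] [Field Ω] [Algebra k Ω]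
    (R : Subalgebra k (HahnSeries ℤ Ω)) : R ≤ orderClosure R :=
  fun z hz N => ⟨z, hz, by simp⟩

lemma orderClosure_mono {k Ω : Type} [Field k] [Field Ω] [Algebra k Ω]
    {R S : Subalgebra k (HahnSeries ℤ Ω)} (h : R ≤ S) : orderClosure R ≤ orderClosure S :=
  fun _ hz N => let ⟨w, hw, h'⟩ := hz N; ⟨w, h hw, h'⟩

lemma orderClosure_le_of_le {k Ω : Type} [Field k] [Field Ω] [Algebra k Ω]
    {R S : Subalgebra k (HahnSeries ℤ Ω)} (h : R ≤ orderClosure S) :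
    orderClosure R ≤ orderClosure S := by
  intro z hz N
  obtain ⟨w, hw, h1⟩ := hz N
  obtain ⟨w', hw', h2⟩ := h hw N
  exact ⟨w', hw', by simpa using le_orderTop_add h1 h2⟩

lemma inv_one_add_mem_orderClosure {k Ω : Type} [Field k] [Field Ω] [Algebra k Ω]
    {R : Subalgebra k (HahnSeries ℤ Ω)} {x : HahnSeries ℤ Ω} (hx : x ∈ orderClosure R)
    (hpos : 0 < x.orderTop) : (1 + x)⁻¹ ∈ orderClosure R := by
  have hmem : (1 + x)⁻¹ ∈ orderClosure (orderClosure R) := by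
    have hne : 1 + x ≠ 0 := by
      intro h
      have : x = -1 := by linear_combination h
      rw [this, HahnSeries.orderTop_neg, HahnSeries.orderTop_one] at hpos
      exact lt_irrefl _ hpos
    have hord : (1 + x)⁻¹.orderTop = 0 := by
      have h1 : (1 + x).orderTop = ((0 : ℤ) : WithTop ℤ) := by
        rw [HahnSeries.orderTop_add_eq_left] <;> rw [HahnSeries.orderTop_one]
        · rfl
        · exact hpos
      have := orderTop_zpow_int h1 (-1)
      simpa using this
    have h1x : (1 : WithTop ℤ) ≤ x.orderTop := by
      by_cases h0 : x = 0
      · simp [h0]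
      · obtain ⟨n, hn⟩ := exists_int_eq_orderTop h0
        rw [hn] at hpos ⊢
        norm_cast at hpos ⊢
    intro N
    refine ⟨∑ i ∈ Finset.range N.toNat, (-x) ^ i, sum_mem fun i _ => pow_mem (neg_mem hx) i, ?_⟩
    have e : (1 + x)⁻¹ - ∑ i ∈ Finset.range N.toNat, (-x) ^ i = (-x) ^ N.toNat * (1 + x)⁻¹ := by
      have := geom_sum_mul (-x) N.toNat
      field_simp
      linear_combination this
    rw [e, HahnSeries.orderTop_mul, hord, add_zero, orderTop_pow', HahnSeries.orderTop_neg]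
    calc (N : WithTop ℤ) ≤ ((N.toNat : ℤ) : WithTop ℤ) := by exact_mod_cast Int.self_le_toNat N
      _ = N.toNat • ((1 : ℤ) : WithTop ℤ) := by rw [← WithTop.coe_nsmul]; simp
      _ ≤ _ := nsmul_le_nsmul_right h1x _
  exact orderClosure_le_of_le le_rfl hmem

end LaurentOrder

section ResidueLemma

lemma orderTop_aeval_nonneg {k Ω : Type} [Field k] [Field Ω] [Algebra k Ω]
    {R₀ : Subalgebra k (HahnSeries ℤ Ω)} (h₀ : ∀ x ∈ R₀, 0 ≤ x.orderTop)
    {ρ : HahnSeries ℤ Ω} (hρ : 0 < ρ.orderTop) (p : Polynomial R₀) :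
    0 ≤ (Polynomial.aeval ρ p).orderTop := by
  induction p using Polynomial.induction_on' with
  | add p q hp hq => rw [map_add]; exact le_orderTop_add hp hq
  | monomial n a =>
    rw [Polynomial.aeval_monomial, HahnSeries.orderTop_mul, orderTop_pow']
    exact add_nonneg (h₀ _ a.2) (nsmul_nonneg hρ.le n)

lemma exists_coeff_zero_eq_of_mul_pow_eq {k Ω : Type} [Field k] [Field Ω] [Algebra k Ω]
    {R₀ : Subalgebra k (HahnSeries ℤ Ω)}
    (h₀ : ∀ x ∈ R₀, 0 ≤ x.orderTop ∧ (x ≠ 0 → x.coeff 0 ≠ 0))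
    {ρ : HahnSeries ℤ Ω} (hρ0 : ρ ≠ 0) (hρ : 0 < ρ.orderTop) {z : HahnSeries ℤ Ω}
    (hz : 0 ≤ z.orderTop) (n : ℕ) :
    ∀ p : Polynomial R₀, z * ρ ^ n = Polynomial.aeval ρ p → ∃ x ∈ R₀, z.coeff 0 = x.coeff 0 := by
  have hp (p : Polynomial R₀) : Polynomial.aeval ρ p =
      ρ * Polynomial.aeval ρ p.divX + (p.coeff 0 : HahnSeries ℤ Ω) := by
    conv_lhs => rw [← p.X_mul_divX_add]
    rw [map_add, map_mul, Polynomial.aeval_X, Polynomial.aeval_C]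
    rfl
  have hpos (x : HahnSeries ℤ Ω) (hx : 0 ≤ x.orderTop) : (ρ * x).coeff 0 = 0 := by
    apply HahnSeries.coeff_eq_zero_of_lt_orderTop
    rw [HahnSeries.orderTop_mul]
    exact add_pos_of_pos_of_nonneg hρ hx
  have hnn := orderTop_aeval_nonneg (fun x hx => (h₀ x hx).1) hρ
  induction n with
  | zero =>
    intro p h
    refine ⟨p.coeff 0, (p.coeff 0).2, ?_⟩
    rw [pow_zero, mul_one] at h
    rw [h, hp, HahnSeries.coeff_add, hpos _ (hnn _), zero_add]
  | succ n ih =>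
    intro p h
    have h1 : z * ρ ^ (n + 1) = ρ * (z * ρ ^ n) := by ring
    have h2 : ((p.coeff 0 : R₀) : HahnSeries ℤ Ω) =
        ρ * (z * ρ ^ n - Polynomial.aeval ρ p.divX) := by
      rw [hp] at h
      linear_combination h1 - h
    have h3 : ((p.coeff 0 : R₀) : HahnSeries ℤ Ω) = 0 := by
      by_contra hne
      refine (h₀ _ (p.coeff 0).2).2 hne ?_
      rw [h2]
      apply hpos
      apply le_orderTop_sub _ (hnn _)
      rw [HahnSeries.orderTop_mul, orderTop_pow']
      exact add_nonneg hz (nsmul_nonneg hρ.le n)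
    apply ih p.divX
    rw [h3] at h2
    have := (mul_eq_zero.mp h2.symm).resolve_left hρ0
    linear_combination this

lemma exists_mul_pow_eq_aeval {k Ω : Type} [Field k] [Field Ω] [Algebra k Ω]
    {R₀ : Subalgebra k (HahnSeries ℤ Ω)} {ρ : HahnSeries ℤ Ω} (hρ0 : ρ ≠ 0)
    {z : HahnSeries ℤ Ω} (hz : z ∈ Algebra.adjoin k ((R₀ : Set (HahnSeries ℤ Ω)) ∪ {ρ, ρ⁻¹})) :
    ∃ n : ℕ, ∃ p : Polynomial R₀, z * ρ ^ n = Polynomial.aeval ρ p := by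
  induction hz using Algebra.adjoin_induction with
  | mem x hx =>
    rcases hx with hx | rfl | rfl
    · exact ⟨0, Polynomial.C ⟨x, hx⟩, by simp⟩
    · exact ⟨0, Polynomial.X, by simp⟩
    · exact ⟨1, 1, by simp [hρ0]⟩
  | algebraMap r => exact ⟨0, Polynomial.C (algebraMap k R₀ r), by simp⟩
  | add x y _ _ hx hy =>
    obtain ⟨m, p, hp⟩ := hx
    obtain ⟨n, q, hq⟩ := hy
    refine ⟨m + n, p * Polynomial.X ^ n + q * Polynomial.X ^ m, ?_⟩
    rw [map_add, map_mul, map_mul, ← hp, ← hq, map_pow, map_pow, Polynomial.aeval_X]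
    ring
  | mul x y _ _ hx hy =>
    obtain ⟨m, p, hp⟩ := hx
    obtain ⟨n, q, hq⟩ := hy
    refine ⟨m + n, p * q, ?_⟩
    rw [map_mul, ← hp, ← hq]
    ring

lemma exists_coeff_zero_eq_of_mem_orderClosure {k Ω : Type} [Field k] [Field Ω] [Algebra k Ω]
    {R₀ : Subalgebra k (HahnSeries ℤ Ω)}
    (h₀ : ∀ x ∈ R₀, 0 ≤ x.orderTop ∧ (x ≠ 0 → x.coeff 0 ≠ 0))
    {ρ : HahnSeries ℤ Ω} (hρ0 : ρ ≠ 0) (hρ : 0 < ρ.orderTop) {z : HahnSeries ℤ Ω}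
    (hz0 : 0 ≤ z.orderTop)
    (hz : z ∈ orderClosure (Algebra.adjoin k ((R₀ : Set (HahnSeries ℤ Ω)) ∪ {ρ, ρ⁻¹}))) :
    ∃ x ∈ R₀, z.coeff 0 = x.coeff 0 := by
  obtain ⟨w, hw, h⟩ := hz 1
  obtain ⟨n, p, hp⟩ := exists_mul_pow_eq_aeval hρ0 hw
  have h01 : (0 : WithTop ℤ) < ((1 : ℤ) : WithTop ℤ) := by norm_cast
  have hw0 : 0 ≤ w.orderTop := by
    have : w = z - (z - w) := by ring
    rw [this]
    exact le_orderTop_sub hz0 (h01.le.trans h)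
  obtain ⟨x, hx, hwx⟩ := exists_coeff_zero_eq_of_mul_pow_eq h₀ hρ0 hρ hw0 n p hp
  refine ⟨x, hx, hwx ▸ ?_⟩
  have : (z - w).coeff 0 = 0 := HahnSeries.coeff_eq_zero_of_lt_orderTop (h01.trans_le h)
  rw [HahnSeries.coeff_sub] at this
  exact sub_eq_zero.mp this

end ResidueLemma

section CurveField

/-- `K` is algebraic over each subextension generated by a nonconstant element. -/
def IsCurveField (k K : Type) [Field k] [Field K] [Algebra k K] : Prop :=
  ∀ z w : K, z ∉ Set.range (algebraMap k K) → IsAlgebraic (IntermediateField.adjoin k {z}) w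

open Polynomial in
lemma exists_sub_algebraMap_inv_notMem {k K : Type} [Field k] [IsAlgClosed k] [Field K]
    [Algebra k K] (hK : IsCurveField k K) (O : ValuationSubring K)
    (hk : ∀ c, algebraMap k K c ∈ O) (hO : O ≠ ⊤) {z : K} (hz : z ∈ O) :
    ∃ c : k, z = algebraMap k K c ∨ (z - algebraMap k K c)⁻¹ ∉ O := by
  by_contra! hcon
  have hmem (p : k[X]) : aeval z p ∈ O := by
    induction p using Polynomial.induction_on' with
    | add p q hp hq => rw [map_add]; exact add_mem hp hq
    | monomial n a => rw [aeval_monomial]; exact mul_mem (hk a) (pow_mem hz n)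
  have hinv (p : k[X]) : (aeval z p)⁻¹ ∈ O := by
    rw [(IsAlgClosed.splits p).eq_prod_roots]
    rw [map_mul, aeval_C, map_multiset_prod, Multiset.map_map, mul_inv, ← map_inv₀]
    refine mul_mem (hk _) ?_
    induction p.roots using Multiset.induction_on with
    | empty => simp
    | cons a s ih =>
      rw [Multiset.map_cons, Multiset.prod_cons, mul_inv]
      exact mul_mem (by simpa using (hcon a).2) ih
  have hle (x : IntermediateField.adjoin k {z}) : (x : K) ∈ O := by
    obtain ⟨r, s, h⟩ := (IntermediateField.mem_adjoin_simple_iff k _).mp x.2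
    rw [h, div_eq_mul_inv]
    exact mul_mem (hmem r) (hinv s)
  apply hO
  rw [eq_top_iff]
  intro w _
  have hw : IsAlgebraic (IntermediateField.adjoin k {z}) w :=
    hK z w (fun ⟨c, hc⟩ => (hcon c).1 hc.symm)
  have hw' : IsIntegral O w := by
    let f : IntermediateField.adjoin k {z} →+* O :=
      (algebraMap (IntermediateField.adjoin k {z}) K).codRestrict O.toSubring hle
    obtain ⟨p, hp, h⟩ := hw.isIntegral
    refine ⟨p.map f, hp.map f, ?_⟩
    rw [eval₂_map]
    exact h
  obtain ⟨y, rfl⟩ := IsIntegrallyClosed.isIntegral_iff.mp hw'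
  exact y.2

end CurveField

section Approximation

variable {k K Ω : Type} [Field k] [Field K] [Field Ω] [Algebra k K] [Algebra k Ω]

/-- The valuation subring of elements sent to series without polar part. -/
def orderValuationSubring (φ : K →ₐ[k] HahnSeries ℤ Ω) : ValuationSubring K where
  carrier := {z | 0 ≤ (φ z).orderTop}
  mul_mem' := by
    intro a b ha hb
    simp only [Set.mem_ofPred_eq, map_mul, HahnSeries.orderTop_mul] at *
    exact add_nonneg ha hb
  one_mem' := by simp
  add_mem' := by
    intro a b ha hb
    simp only [Set.mem_ofPred_eq, map_add] at *
    exact le_orderTop_add ha hb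
  zero_mem' := by simp
  neg_mem' := by simp
  mem_or_inv_mem' := by
    intro x
    by_cases hx : x = 0
    · left; simp [hx]
    · obtain ⟨n, hn⟩ := exists_int_eq_orderTop ((map_ne_zero φ).mpr hx)
      have h1 := orderTop_zpow_int hn (-1)
      simp only [Set.mem_ofPred_eq, map_inv₀]
      rw [zpow_neg_one] at h1
      rw [hn, h1]
      norm_cast
      omega

lemma exists_orderTop_lt_sub (hk : IsAlgClosed k) (hK : IsCurveField k K)
    (φ : K →ₐ[k] HahnSeries ℤ Ω) {t : K} {q : ℤ} (hq : 0 < q)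
    (ht : (φ t).orderTop = (q : WithTop ℤ)) {z : K} {n : ℤ}
    (hz : (φ z).orderTop = ((n * q : ℤ) : WithTop ℤ)) :
    ∃ c : k, (φ z).orderTop < (φ (z - algebraMap k K c * t ^ n)).orderTop := by
  have ht0 : t ≠ 0 := by rintro rfl; simp at ht
  set O := orderValuationSubring φ
  have hO : O ≠ ⊤ := by
    intro h
    have : t⁻¹ ∈ O := h ▸ ValuationSubring.mem_top _
    change 0 ≤ (φ t⁻¹).orderTop at this
    have h1 := orderTop_zpow_int ht (-1)
    rw [zpow_neg_one] at h1
    rw [map_inv₀, h1] at this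
    norm_cast at this
    omega
  have hu : z * t ^ (-n) ∈ O := by
    change 0 ≤ (φ (z * t ^ (-n))).orderTop
    rw [map_mul, map_zpow₀, HahnSeries.orderTop_mul, hz, orderTop_zpow_int ht]
    norm_cast
    apply le_of_eq
    ring
  obtain ⟨c, hc⟩ := exists_sub_algebraMap_inv_notMem hK O (fun c => by
    change 0 ≤ (φ (algebraMap k K c)).orderTop
    rw [AlgHom.commutes]
    exact orderTop_algebraMap_nonneg c) hO hu
  refine ⟨c, ?_⟩
  have e : z - algebraMap k K c * t ^ n = (z * t ^ (-n) - algebraMap k K c) * t ^ n := by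
    rw [sub_mul, mul_assoc, ← zpow_add₀ ht0]
    simp
  have hpos : 0 < (φ (z * t ^ (-n) - algebraMap k K c)).orderTop := by
    rcases hc with hc | hc
    · rw [hc]; simp
    · set u := z * t ^ (-n) - algebraMap k K c
      by_contra hneg
      apply hc
      change 0 ≤ (φ u⁻¹).orderTop
      by_cases hu0 : u = 0
      · simp [hu0]
      obtain ⟨m, hm⟩ := exists_int_eq_orderTop ((map_ne_zero φ).mpr hu0)
      have h1 := orderTop_zpow_int hm (-1)
      rw [zpow_neg_one] at h1
      rw [map_inv₀, h1]
      rw [hm] at hneg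
      norm_cast at hneg ⊢
      omega
  rw [e, map_mul, HahnSeries.orderTop_mul, map_zpow₀, orderTop_zpow_int ht, hz]
  by_cases h0 : (φ (z * t ^ (-n) - algebraMap k K c)).orderTop = ⊤
  · rw [h0, top_add]; exact WithTop.coe_lt_top _
  · obtain ⟨m, hm⟩ := WithTop.ne_top_iff_exists.mp h0
    rw [← hm] at hpos ⊢
    norm_cast at hpos ⊢
    omega

lemma zpow_mem_adjoin_pair {k F : Type} [Field k] [Field F] [Algebra k F] (x : F) (n : ℤ) :
    x ^ n ∈ Algebra.adjoin k {x, x⁻¹} := by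
  rcases n.eq_nat_or_neg with ⟨m, rfl | rfl⟩
  · rw [zpow_natCast]
    exact pow_mem (Algebra.subset_adjoin (by simp)) m
  · rw [zpow_neg, zpow_natCast, ← inv_pow]
    exact pow_mem (Algebra.subset_adjoin (by simp)) m

lemma exists_uniformizer (hk : IsAlgClosed k) (hK : IsCurveField k K)
    (φ : K →ₐ[k] HahnSeries ℤ Ω) {y : K} (hy : y ≠ 0) (hvy : (φ y).orderTop ≠ 0) :
    ∃ (t : K) (q : ℤ), 0 < q ∧ (φ t).orderTop = (q : WithTop ℤ) ∧
      ∀ z, φ z ∈ orderClosure (Algebra.adjoin k {φ t, (φ t)⁻¹}) := by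
  classical
  have hex : ∃ n : ℕ, 0 < n ∧ ∃ t : K, (φ t).orderTop = ((n : ℤ) : WithTop ℤ) := by
    obtain ⟨n, hn⟩ := exists_int_eq_orderTop ((map_ne_zero φ).mpr hy)
    have hn0 : n ≠ 0 := by rintro rfl; exact hvy hn
    rcases lt_or_gt_of_ne hn0 with h | h
    · refine ⟨(-n).toNat, by omega, y⁻¹, ?_⟩
      have h1 := orderTop_zpow_int hn (-1)
      rw [zpow_neg_one] at h1
      rw [map_inv₀, h1, Int.toNat_of_nonneg (by omega)]
      simp
    · exact ⟨n.toNat, by omega, y, by rw [hn, Int.toNat_of_nonneg (by omega)]⟩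
  obtain ⟨hq, t, ht⟩ := Nat.find_spec hex
  have hmin := fun m => Nat.find_min hex (m := m)
  set q := Nat.find hex
  have hqz : (0 : ℤ) < q := by exact_mod_cast hq
  have hdvd (z : K) (hz : z ≠ 0) : ∃ n : ℤ, (φ z).orderTop = ((n * q : ℤ) : WithTop ℤ) := by
    obtain ⟨m, hm⟩ := exists_int_eq_orderTop ((map_ne_zero φ).mpr hz)
    refine ⟨m / q, ?_⟩
    have h1 : (φ (z * t ^ (-(m / q)))).orderTop = ((m % q : ℤ) : WithTop ℤ) := by
      rw [map_mul, map_zpow₀, HahnSeries.orderTop_mul, hm, orderTop_zpow_int ht]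
      norm_cast
      rw [Int.emod_def]
      ring
    have h2 : m % q = 0 := by
      by_contra hne
      have h3 := Int.emod_nonneg m hqz.ne'
      have h4 := Int.emod_lt_of_pos m hqz
      refine hmin (m % q).toNat (by omega) ⟨by omega, z * t ^ (-(m / q)), ?_⟩
      rw [h1, Int.toNat_of_nonneg h3]
    rw [hm, Int.ediv_mul_cancel (Int.dvd_of_emod_eq_zero h2)]
  refine ⟨t, q, hqz, ht, fun z N => ?_⟩
  have key : ∀ L : ℕ, ∀ z : K, ((N - L : ℤ) : WithTop ℤ) ≤ (φ z).orderTop →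
      ∃ w ∈ Algebra.adjoin k {φ t, (φ t)⁻¹}, (N : WithTop ℤ) ≤ (φ z - w).orderTop := by
    intro L
    induction L with
    | zero => exact fun z hz => ⟨0, zero_mem _, by simpa using hz⟩
    | succ L ih =>
      intro z hz
      by_cases hz0 : z = 0
      · exact ⟨0, zero_mem _, by simp [hz0]⟩
      obtain ⟨n, hn⟩ := hdvd z hz0
      obtain ⟨c, hc⟩ := exists_orderTop_lt_sub hk hK φ hqz ht hn
      obtain ⟨w, hw, h⟩ := ih (z - algebraMap k K c * t ^ n) (by
        by_cases h0 : φ (z - algebraMap k K c * t ^ n) = 0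
        · simp [h0]
        obtain ⟨m, hm⟩ := exists_int_eq_orderTop h0
        rw [hn] at hc hz
        rw [hm] at hc ⊢
        norm_cast at hc hz ⊢
        push_cast at hz
        omega)
      refine ⟨w + algebraMap k _ c * (φ t) ^ n,
        add_mem hw (mul_mem (Subalgebra.algebraMap_mem _ c) (zpow_mem_adjoin_pair _ n)), ?_⟩
      convert h using 2
      rw [map_sub, map_mul, map_zpow₀, AlgHom.commutes]
      ring
  obtain ⟨M, hM⟩ := exists_int_le_orderTop (φ z)
  refine key (N - M).toNat z (le_trans ?_ hM)
  norm_cast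
  omega

end Approximation

section Roots

open HahnSeries

variable {Ω : Type} [Field Ω] [CharZero Ω]

lemma hahn_binomial_one (x : orderTopSubOnePos ℤ Ω) : x ^ (1 : Ω) = x := by
  suffices (x ^ (1 : Ω)).val.val = x.val.val from SetLike.coe_eq_coe.mp (Units.val_inj.mp this)
  have hx : 0 < (x.val.val - 1).orderTop := x.2
  rw [binomial_power, val_toOrderTopSubOnePos_coe]
  ext g
  rw [SummableFamily.coeff_hsum, finsum_eq_sum_of_support_subset (s := {0, 1})]
  · rw [Finset.sum_pair zero_ne_one, SummableFamily.binomialFamily_apply hx,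
      SummableFamily.binomialFamily_apply hx]
    simp
  · intro n hn
    by_contra h
    apply hn
    dsimp
    rw [SummableFamily.binomialFamily_apply hx]
    have h2 : 1 < n := by simp at h; omega
    have : Ring.choose (1 : Ω) n = 0 := by
      have := Ring.choose_natCast (R := Ω) 1 n
      rw [Nat.choose_eq_zero_of_lt h2] at this
      simpa using this
    rw [this]; simp

lemma hahn_binomial_pow (x : orderTopSubOnePos ℤ Ω) (r : Ω) {n : ℕ} (hn : 0 < n) :
    (x ^ r) ^ n = x ^ (n * r) := by
  induction n, hn using Nat.le_induction with
  | base => simp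
  | succ n _ ih => rw [pow_succ, ih, ← HahnSeries.pow_add]; congr 1; push_cast; ring

/-- Over an algebraically closed field of characteristic zero every Laurent series of positive
order `p` is the `p`-th power of a series of order one. -/
lemma exists_pow_eq_of_orderTop {Ω : Type} [Field Ω] [CharZero Ω] [IsAlgClosed Ω]
    {T : HahnSeries ℤ Ω} {p : ℤ} (hp : 0 < p) (hT : T.orderTop = (p : WithTop ℤ)) :
    ∃ ρ : HahnSeries ℤ Ω, ρ.orderTop = ((1 : ℤ) : WithTop ℤ) ∧ ρ ^ p = T := by
  have hT0 : T ≠ 0 := by rintro rfl; simp at hT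
  lift p to ℕ using hp.le
  have hp0 : 0 < p := by exact_mod_cast hp
  obtain ⟨c, hc⟩ := IsAlgClosed.exists_pow_nat_eq T.leadingCoeff hp0
  have hl := leadingCoeff_ne_zero.mpr hT0
  have hc0 : c ≠ 0 := by
    rintro rfl
    rw [zero_pow hp0.ne'] at hc
    exact hl hc.symm
  set x : HahnSeries ℤ Ω := single 1 c
  have hx0 : x ≠ 0 := by simpa [x] using hc0
  have hx : x.orderTop = ((1 : ℤ) : WithTop ℤ) := orderTop_single hc0
  have hxp : (x ^ p).leadingCoeff = T.leadingCoeff := by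
    rw [single_pow, leadingCoeff_of_single, hc]
  have hxpo : (x ^ p).orderTop = (p : ℤ) := by
    simpa using orderTop_zpow_int hx p
  set y : HahnSeries ℤ Ω := T * (x ^ p)⁻¹
  have hyx : y * x ^ p = T := by simp [y, hx0]
  have hy0 : y ≠ 0 := mul_ne_zero hT0 (inv_ne_zero (pow_ne_zero _ hx0))
  have hy : 0 < (y - 1).orderTop := by
    rw [orderTop_self_sub_one_pos_iff]
    constructor
    · have h := congrArg orderTop hyx
      rw [orderTop_mul, hT, hxpo] at h
      obtain ⟨m, hm⟩ := exists_int_eq_orderTop hy0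
      rw [hm] at h ⊢
      norm_cast at h ⊢
      omega
    · have h := congrArg leadingCoeff hyx
      rw [leadingCoeff_mul, hxp] at h
      exact mul_right_cancel₀ hl (by rw [h, one_mul])
  let Y : orderTopSubOnePos ℤ Ω := ⟨Units.mk0 y hy0, hy⟩
  let Z := Y ^ ((p : Ω)⁻¹)
  have hZ : Z ^ p = Y := by
    rw [hahn_binomial_pow _ _ hp0, mul_inv_cancel₀ (by exact_mod_cast hp0.ne'), hahn_binomial_one]
  have hZ' : Z.val.val ^ p = y := by
    have := congrArg (fun u => u.val.val) hZ
    simpa [Y] using this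
  refine ⟨Z.val.val * x, ?_, ?_⟩
  · rw [orderTop_mul, hx, ((orderTop_self_sub_one_pos_iff _).mp Z.2).1, zero_add]
  · rw [zpow_natCast, mul_pow, hZ', hyx]

end Roots

section TwoEmbeddings

variable {k K Ω : Type} [Field k] [Field K] [Field Ω] [Algebra k K] [Algebra k Ω]

lemma coeff_zero_ne_zero_of_orderTop_eq {x : HahnSeries ℤ Ω} (hx : x.orderTop = 0) :
    x.coeff 0 ≠ 0 :=
  HahnSeries.coeff_orderTop_ne (by rw [hx]; rfl)

lemma orderTop_sub_C_coeff_pos {x : HahnSeries ℤ Ω} (hx : 0 ≤ x.orderTop) :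
    ((1 : ℤ) : WithTop ℤ) ≤ (x - HahnSeries.C (x.coeff 0)).orderTop := by
  rw [HahnSeries.le_orderTop_iff_forall]
  intro j hj
  have hj' : j < 1 := by exact_mod_cast hj
  rcases (show j < 0 ∨ j = 0 by omega) with h | rfl
  · rw [HahnSeries.coeff_sub, HahnSeries.coeff_eq_zero_of_lt_orderTop
      (lt_of_lt_of_le (by exact_mod_cast h) hx), HahnSeries.C_apply,
      HahnSeries.coeff_single_of_ne h.ne, sub_zero]
  · rw [HahnSeries.coeff_sub, HahnSeries.C_apply, HahnSeries.coeff_single_same, sub_self]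

lemma mem_range_coeff_zero_of_trivial (hk : IsAlgClosed k) (hK : IsCurveField k K)
    (φ₁ φ₂ : K →ₐ[k] HahnSeries ℤ Ω) (h₁ : ∀ z ≠ 0, (φ₁ z).orderTop = 0)
    (h₂ : ∃ z ≠ 0, (φ₂ z).orderTop ≠ 0) {b : Ω}
    (hb : HahnSeries.C b ∈ Algebra.adjoin k (Set.range φ₁ ∪ Set.range φ₂)) :
    ∃ z, b = (φ₁ z).coeff 0 := by
  obtain ⟨y, hy, hvy⟩ := h₂
  obtain ⟨t, q, hq, ht, h⟩ := exists_uniformizer hk hK φ₂ hy hvy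
  have hv : 0 < (φ₂ t).orderTop := by rw [ht]; exact_mod_cast hq
  have h0 : φ₂ t ≠ 0 := by rintro h; simp [h] at ht
  obtain ⟨x, ⟨z, hz⟩, hx⟩ := exists_coeff_zero_eq_of_mem_orderClosure (R₀ := φ₁.range)
    (ρ := φ₂ t) (z := HahnSeries.C b) (by
      rintro _ ⟨z, rfl⟩
      by_cases hz : z = 0
      · simp [hz]
      · exact ⟨(h₁ z hz).ge, fun _ => coeff_zero_ne_zero_of_orderTop_eq (h₁ z hz)⟩) h0 hv
    (orderTop_algebraMap_nonneg (k := Ω) b) (by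
      refine (Algebra.adjoin_le ?_) hb
      rintro _ (⟨z, rfl⟩ | ⟨z, rfl⟩)
      · exact le_orderClosure _ (Algebra.subset_adjoin (Or.inl ⟨z, rfl⟩))
      · exact orderClosure_mono (Algebra.adjoin_mono Set.subset_union_right) (h z))
  refine ⟨z, ?_⟩
  have hb0 : (HahnSeries.C b : HahnSeries ℤ Ω).coeff 0 = b := coeff_zero_algebraMap (k := Ω) b
  rw [← hb0]
  exact hx.trans (congrArg (fun u => HahnSeries.coeff u 0) hz.symm)

/-- Taking the constant coefficient on a subalgebra of series without polar part. -/
noncomputable def coeffZeroHom (R : Subalgebra k (HahnSeries ℤ Ω))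
    (h : ∀ x ∈ R, 0 ≤ x.orderTop) : R →ₐ[k] Ω where
  toFun x := (x : HahnSeries ℤ Ω).coeff 0
  map_one' := by simp
  map_mul' x y := coeff_zero_mul_of_nonneg (h _ x.2) (h _ y.2)
  map_zero' := by simp
  map_add' x y := by simp
  commutes' c := coeff_zero_algebraMap c

/-- The subalgebra of series without polar part. -/
def integralSeries (k Ω : Type) [Field k] [Field Ω] [Algebra k Ω] :
    Subalgebra k (HahnSeries ℤ Ω) where
  carrier := {x | 0 ≤ x.orderTop}
  mul_mem' := by
    intro a b ha hb
    simp only [Set.mem_ofPred_eq, HahnSeries.orderTop_mul] at *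
    exact add_nonneg ha hb
  add_mem' := fun ha hb => le_orderTop_add ha hb
  algebraMap_mem' := orderTop_algebraMap_nonneg

lemma transcendental_of_notMem_range {k Ω : Type} [Field k] [Field Ω] [Algebra k Ω]
    [IsAlgClosed k] {μ : Ω} (hμ : μ ∉ Set.range (algebraMap k Ω)) : Transcendental k μ := by
  intro h
  exact hμ (minpoly.mem_range_of_degree_eq_one k μ
    (IsAlgClosed.degree_eq_one_of_irreducible k (minpoly.irreducible h.isIntegral)))

lemma bot_coeff_zero_ne_zero (x : HahnSeries ℤ Ω) (hx : x ∈ (⊥ : Subalgebra k (HahnSeries ℤ Ω))) :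
    0 ≤ x.orderTop ∧ (x ≠ 0 → x.coeff 0 ≠ 0) := by
  obtain ⟨c, rfl⟩ := Algebra.mem_bot.mp hx
  refine ⟨orderTop_algebraMap_nonneg c, fun h => ?_⟩
  rw [coeff_zero_algebraMap]
  contrapose! h
  rw [(map_eq_zero _).mp h, map_zero]

/-- If `T` has order `q` and its initial coefficient with respect to `ρ ∈ S` is a constant, then
the inverse of `T` lies in the closure of every subalgebra whose closure contains `T`. -/
lemma inv_mem_orderClosure {S : Subalgebra k (HahnSeries ℤ Ω)} {ρ T : HahnSeries ℤ Ω}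
    (hρ : ρ.orderTop = ((1 : ℤ) : WithTop ℤ)) (hS : Algebra.adjoin k {ρ, ρ⁻¹} ≤ S)
    {q : ℤ} (hT : T.orderTop = (q : WithTop ℤ)) (hTS : T ∈ orderClosure S) {c : k}
    (hc : (T * ρ ^ (-q)).coeff 0 = algebraMap k Ω c) : T⁻¹ ∈ orderClosure S := by
  have hρ0 : ρ ≠ 0 := by rintro rfl; simp at hρ
  have hpow (n : ℤ) : ρ ^ n ∈ orderClosure S := le_orderClosure _ (hS (zpow_mem_adjoin_pair ρ n))
  have hu : (T * ρ ^ (-q)).orderTop = 0 := by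
    rw [HahnSeries.orderTop_mul, hT, orderTop_zpow_int hρ]
    norm_cast
    omega
  have hc0 : c ≠ 0 := by
    rintro rfl
    exact coeff_zero_ne_zero_of_orderTop_eq hu (by rw [hc, map_zero])
  set a : HahnSeries ℤ Ω := algebraMap k _ c
  have ha : a ≠ 0 := by simpa [a] using hc0
  have ha' : a⁻¹ = algebraMap k _ c⁻¹ := (map_inv₀ _ c).symm
  have haS : a⁻¹ ∈ orderClosure S := by rw [ha']; exact Subalgebra.algebraMap_mem _ _
  set x : HahnSeries ℤ Ω := T * ρ ^ (-q) * a⁻¹ - 1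
  have hx : x ∈ orderClosure S := sub_mem (mul_mem (mul_mem hTS (hpow _)) haS) (one_mem _)
  have hxpos : 0 < x.orderTop := by
    have h1 := orderTop_sub_C_coeff_pos hu.ge
    rw [hc] at h1
    have e : x = (T * ρ ^ (-q) - a) * a⁻¹ := by
      simp only [x]
      field_simp
    rw [e, HahnSeries.orderTop_mul, ha',
      orderTop_algebraMap_of_ne_zero (inv_ne_zero hc0), add_zero]
    exact lt_of_lt_of_le (by norm_cast) h1
  have hT0 : T ≠ 0 := by rintro rfl; simp at hT
  have h := inv_one_add_mem_orderClosure hx hxpos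
  have e : T⁻¹ = (1 + x)⁻¹ * (ρ ^ (-q) * a⁻¹) := by
    have : 1 + x = T * ρ ^ (-q) * a⁻¹ := by simp only [x]; ring
    rw [this]
    have := zpow_ne_zero (-q) hρ0
    field_simp
  rw [e]
  exact mul_mem h (mul_mem (hpow _) haS)

/-- A series `T` not approximable by Laurent polynomials in `ρ` has an expansion in `ρ` with a
first nonconstant coefficient. -/
lemma exists_nonconstant_coeff {ρ T : HahnSeries ℤ Ω}
    (hρ : ρ.orderTop = ((1 : ℤ) : WithTop ℤ)) {q : ℤ} (hT : T.orderTop = (q : WithTop ℤ))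
    (hTn : T ∉ orderClosure (Algebra.adjoin k {ρ, ρ⁻¹})) :
    ∃ M : HahnSeries ℤ Ω, M.orderTop = 0 ∧ M.coeff 0 ∉ Set.range (algebraMap k Ω) ∧
      ∀ S : Subalgebra k (HahnSeries ℤ Ω), ρ ∈ S → ρ⁻¹ ∈ S → M ∈ S → M⁻¹ ∈ S →
        T ∈ orderClosure S ∧ T⁻¹ ∈ orderClosure S := by
  have hρ0 : ρ ≠ 0 := by rintro rfl; simp at hρ
  have hu : (T * ρ ^ (-q)).orderTop = 0 := by
    rw [HahnSeries.orderTop_mul, hT, orderTop_zpow_int hρ]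
    norm_cast
    omega
  have hadj (S : Subalgebra k (HahnSeries ℤ Ω)) (h1 : ρ ∈ S) (h2 : ρ⁻¹ ∈ S) :
      Algebra.adjoin k {ρ, ρ⁻¹} ≤ S := Algebra.adjoin_le (by rintro x (rfl | rfl) <;> assumption)
  by_cases hc : (T * ρ ^ (-q)).coeff 0 ∈ Set.range (algebraMap k Ω)
  swap
  · refine ⟨_, hu, hc, fun S h1 h2 h3 h4 => ?_⟩
    have hq := hadj S h1 h2 (zpow_mem_adjoin_pair ρ q)
    have hq' := hadj S h1 h2 (zpow_mem_adjoin_pair ρ (-q))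
    have e : T = T * ρ ^ (-q) * ρ ^ q := by
      rw [mul_assoc, ← zpow_add₀ hρ0]
      simp
    have e' : T⁻¹ = (T * ρ ^ (-q))⁻¹ * ρ ^ (-q) := by
      rw [mul_inv, mul_assoc, inv_mul_cancel₀ (zpow_ne_zero _ hρ0), mul_one]
    constructor
    · rw [e]
      exact le_orderClosure S (mul_mem h3 hq)
    · rw [e']
      exact le_orderClosure S (mul_mem h4 hq')
  obtain ⟨c, hc⟩ := hc
  obtain ⟨N, hN⟩ : ∃ N : ℤ, ∀ P ∈ Algebra.adjoin k {ρ, ρ⁻¹},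
      ¬ (N : WithTop ℤ) ≤ (T - P).orderTop := by
    by_contra! h
    exact hTn h
  obtain ⟨m, ⟨P, hP, hm⟩, hmax⟩ := Int.exists_greatest_of_bdd
    (P := fun m => ∃ P ∈ Algebra.adjoin k {ρ, ρ⁻¹}, (m : WithTop ℤ) ≤ (T - P).orderTop)
    ⟨N, fun z ⟨P, hP, hz⟩ => by
      by_contra! h
      exact hN P hP (le_trans (by exact_mod_cast h.le) hz)⟩
    ⟨q, 0, zero_mem _, by rw [sub_zero, hT]⟩
  have hTP : (T - P).orderTop = (m : WithTop ℤ) := by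
    refine le_antisymm ?_ hm
    by_contra! h
    have : m + 1 ≤ m := hmax _ ⟨P, hP, by
      by_cases h0 : T - P = 0
      · simp [h0]
      obtain ⟨j, hj⟩ := exists_int_eq_orderTop h0
      rw [hj] at h ⊢
      norm_cast at h ⊢⟩
    omega
  have hM : ((T - P) * ρ ^ (-m)).orderTop = 0 := by
    rw [HahnSeries.orderTop_mul, hTP, orderTop_zpow_int hρ]
    norm_cast
    omega
  have eM : (T - P) * ρ ^ (-m) * ρ ^ m = T - P := by
    rw [mul_assoc, ← zpow_add₀ hρ0]
    simp
  refine ⟨(T - P) * ρ ^ (-m), hM, ?_, fun S h1 h2 h3 h4 => ?_⟩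
  · rintro ⟨d, hd⟩
    have h1 := orderTop_sub_C_coeff_pos hM.ge
    rw [← hd] at h1
    have h2 : m + 1 ≤ m := hmax _ ⟨P + algebraMap k _ d * ρ ^ m,
      add_mem hP (mul_mem (Subalgebra.algebraMap_mem _ d) (zpow_mem_adjoin_pair ρ m)), by
        have e : T - (P + algebraMap k _ d * ρ ^ m) =
            ((T - P) * ρ ^ (-m) - algebraMap k _ d) * ρ ^ m := by
          rw [sub_mul, eM]
          ring
        rw [e, HahnSeries.orderTop_mul, orderTop_zpow_int hρ]
        refine le_trans ?_ (add_le_add_left h1 _)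
        norm_cast
        omega⟩
    omega
  · have hTS : T ∈ orderClosure S := by
      have e : T = P + (T - P) * ρ ^ (-m) * ρ ^ m := by rw [eM]; ring
      rw [e]
      exact le_orderClosure S (add_mem (hadj S h1 h2 hP)
        (mul_mem h3 (hadj S h1 h2 (zpow_mem_adjoin_pair ρ m))))
    exact ⟨hTS, inv_mem_orderClosure hρ (hadj S h1 h2) hT hTS hc.symm⟩

end TwoEmbeddings

section Generator

variable {k K Ω : Type} [Field k] [Field K] [Field Ω] [Algebra k K] [Algebra k Ω]

lemma laurent_adjoin_coeff_zero {M : HahnSeries ℤ Ω} (hM : M.orderTop = 0)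
    (hμ : Transcendental k (M.coeff 0)) :
    (∀ x ∈ Algebra.adjoin k {M, M⁻¹}, 0 ≤ x.orderTop ∧ (x ≠ 0 → x.coeff 0 ≠ 0)) ∧
    (∀ x ∈ Algebra.adjoin k {M, M⁻¹}, x.coeff 0 ∈ Algebra.adjoin k {M.coeff 0, (M.coeff 0)⁻¹}) := by
  have hM' : M.orderTop = ((0 : ℤ) : WithTop ℤ) := hM
  have hM0 : M ≠ 0 := by rintro rfl; simp at hM
  have hMi : M⁻¹.orderTop = 0 := by simpa using orderTop_zpow_int hM' (-1)
  have hle : Algebra.adjoin k {M, M⁻¹} ≤ integralSeries k Ω := by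
    apply Algebra.adjoin_le
    rintro x (rfl | rfl)
    · exact hM.ge
    · exact hMi.ge
  have hcoeff : M⁻¹.coeff 0 = (M.coeff 0)⁻¹ := by
    apply eq_inv_of_mul_eq_one_left
    rw [← coeff_zero_mul_of_nonneg hMi.ge hM.ge, inv_mul_cancel₀ hM0]
    simp
  refine ⟨fun x hx => ⟨hle hx, fun hx0 => ?_⟩, fun x hx => ?_⟩
  · have : ∃ n : ℕ, ∃ p : Polynomial k, x * M ^ n = Polynomial.aeval M p := by
      clear hx0
      induction hx using Algebra.adjoin_induction with
      | mem x hx =>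
        rcases hx with rfl | rfl
        · exact ⟨0, Polynomial.X, by simp⟩
        · exact ⟨1, 1, by simp [hM0]⟩
      | algebraMap r => exact ⟨0, Polynomial.C r, by simp⟩
      | add x y _ _ hx hy =>
        obtain ⟨m, p, hp⟩ := hx
        obtain ⟨n, q, hq⟩ := hy
        refine ⟨m + n, p * Polynomial.X ^ n + q * Polynomial.X ^ m, ?_⟩
        rw [map_add, map_mul, map_mul, ← hp, ← hq, map_pow, map_pow, Polynomial.aeval_X]
        ring
      | mul x y _ _ hx hy =>
        obtain ⟨m, p, hp⟩ := hx
        obtain ⟨n, q, hq⟩ := hy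
        refine ⟨m + n, p * q, ?_⟩
        rw [map_mul, ← hp, ← hq]
        ring
    obtain ⟨n, p, hp⟩ := this
    have hp0 : p ≠ 0 := by
      rintro rfl
      rw [map_zero] at hp
      exact mul_ne_zero hx0 (pow_ne_zero _ hM0) hp
    let Φ := coeffZeroHom (integralSeries k Ω) (fun x hx => hx)
    let X : integralSeries k Ω := ⟨x, hle hx⟩
    let Y : integralSeries k Ω := ⟨M, hM.ge⟩
    have hXY : X * Y ^ n = Polynomial.aeval Y p := by
      apply Subtype.ext
      have := Polynomial.aeval_algHom_apply (integralSeries k Ω).val Y p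
      simp only [Subalgebra.coe_val] at this
      rw [← this]
      exact hp
    have h2 := congrArg Φ hXY
    rw [← Polynomial.aeval_algHom_apply, map_mul] at h2
    have h3 : Polynomial.aeval (M.coeff 0) p ≠ 0 := fun h => hμ ⟨p, hp0, h⟩
    intro hx00
    apply h3
    have h4 : Φ X = 0 := hx00
    rw [h4, zero_mul] at h2
    exact h2.symm
  · induction hx using Algebra.adjoin_induction with
    | mem x hx =>
      rcases hx with rfl | rfl
      · exact Algebra.subset_adjoin (by simp)
      · rw [hcoeff]; exact Algebra.subset_adjoin (by simp)
    | algebraMap r => rw [coeff_zero_algebraMap]; exact Subalgebra.algebraMap_mem _ _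
    | add x y _ _ hx hy => rw [HahnSeries.coeff_add]; exact add_mem hx hy
    | mul x y hx' hy' hx hy =>
      rw [coeff_zero_mul_of_nonneg (hle hx') (hle hy')]
      exact mul_mem hx hy

lemma exists_laurent_generator [IsAlgClosed Ω] [CharZero Ω] (hk : IsAlgClosed k)
    (hK : IsCurveField k K) (φ₁ φ₂ : K →ₐ[k] HahnSeries ℤ Ω)
    (h₁ : ∃ z ≠ 0, (φ₁ z).orderTop ≠ 0) (h₂ : ∃ z ≠ 0, (φ₂ z).orderTop ≠ 0) {B : Set Ω}
    (hB : ∀ b ∈ B, HahnSeries.C b ∈ Algebra.adjoin k (Set.range φ₁ ∪ Set.range φ₂))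
    (hB' : ∃ b ∈ B, b ∉ Set.range (algebraMap k Ω)) :
    ∃ μ : Ω, Transcendental k μ ∧ ∀ b ∈ B, b ∈ Algebra.adjoin k {μ, μ⁻¹} := by
  obtain ⟨y₁, hy₁, hvy₁⟩ := h₁
  obtain ⟨y₂, hy₂, hvy₂⟩ := h₂
  obtain ⟨t₁, p, hp, ht₁, hφ₁⟩ := exists_uniformizer hk hK φ₁ hy₁ hvy₁
  obtain ⟨t₂, q, hq, ht₂, hφ₂⟩ := exists_uniformizer hk hK φ₂ hy₂ hvy₂
  obtain ⟨ρ, hρ, hρp⟩ := exists_pow_eq_of_orderTop hp ht₁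
  have hρ0 : ρ ≠ 0 := by rintro rfl; simp at hρ
  have hρpos : 0 < ρ.orderTop := by rw [hρ]; norm_cast
  have hb0 (b : Ω) : (HahnSeries.C b : HahnSeries ℤ Ω).coeff 0 = b :=
    coeff_zero_algebraMap (k := Ω) b
  have hbnn (b : Ω) : 0 ≤ (HahnSeries.C b : HahnSeries ℤ Ω).orderTop :=
    orderTop_algebraMap_nonneg (k := Ω) b
  have hadj {S : Subalgebra k (HahnSeries ℤ Ω)} {x : HahnSeries ℤ Ω} (h1 : x ∈ S) (h2 : x⁻¹ ∈ S) :
      Algebra.adjoin k {x, x⁻¹} ≤ S := Algebra.adjoin_le (by rintro x (rfl | rfl) <;> assumption)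
  have hmem (S : Subalgebra k (HahnSeries ℤ Ω)) (hρS : ρ ∈ S) (hρS' : ρ⁻¹ ∈ S)
      (hT : φ₂ t₂ ∈ orderClosure S) (hT' : (φ₂ t₂)⁻¹ ∈ orderClosure S) (b : Ω) (hb : b ∈ B) :
      HahnSeries.C b ∈ orderClosure S := by
    refine (Algebra.adjoin_le ?_) (hB b hb)
    rintro _ (⟨z, rfl⟩ | ⟨z, rfl⟩)
    · refine orderClosure_mono (hadj ?_ ?_) (hφ₁ z)
      · rw [← hρp]
        exact hadj hρS hρS' (zpow_mem_adjoin_pair ρ p)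
      · rw [← hρp, ← zpow_neg]
        exact hadj hρS hρS' (zpow_mem_adjoin_pair ρ (-p))
    · exact orderClosure_le_of_le (hadj hT hT') (hφ₂ z)
  have hbot : Algebra.adjoin k ((⊥ : Subalgebra k (HahnSeries ℤ Ω)) ∪ {ρ, ρ⁻¹} :
      Set (HahnSeries ℤ Ω)) = Algebra.adjoin k {ρ, ρ⁻¹} := by
    rw [Algebra.adjoin_union, Algebra.adjoin_eq, bot_sup_eq]
  have hT : φ₂ t₂ ∉ orderClosure (Algebra.adjoin k {ρ, ρ⁻¹}) := by
    intro hT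
    obtain ⟨b, hb, hb'⟩ := hB'
    have hpow (n : ℤ) : ρ ^ n ∈ orderClosure (Algebra.adjoin k {ρ, ρ⁻¹}) :=
      le_orderClosure _ (zpow_mem_adjoin_pair ρ n)
    have hu : (φ₂ t₂ * ρ ^ (-q)).orderTop = 0 := by
      rw [HahnSeries.orderTop_mul, ht₂, orderTop_zpow_int hρ]
      norm_cast
      omega
    have hres (x : HahnSeries ℤ Ω) (hx : 0 ≤ x.orderTop)
        (h : x ∈ orderClosure (Algebra.adjoin k {ρ, ρ⁻¹})) :
        ∃ c, algebraMap k Ω c = x.coeff 0 := by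
      rw [← hbot] at h
      obtain ⟨y, hy, h⟩ := exists_coeff_zero_eq_of_mem_orderClosure bot_coeff_zero_ne_zero hρ0
        hρpos hx h
      obtain ⟨c, rfl⟩ := Algebra.mem_bot.mp hy
      exact ⟨c, by rw [h, coeff_zero_algebraMap]⟩
    obtain ⟨c, hc⟩ := hres _ hu.ge (mul_mem hT (hpow _))
    have hT' := inv_mem_orderClosure hρ le_rfl ht₂ hT hc.symm
    obtain ⟨d, hd⟩ := hres _ (hbnn b) (hmem _ (Algebra.subset_adjoin (by simp))
      (Algebra.subset_adjoin (by simp)) hT hT' b hb)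
    exact hb' ⟨d, by rw [hd, hb0]⟩
  obtain ⟨M, hM, hμ, hS⟩ := exists_nonconstant_coeff hρ ht₂ hT
  have hμ' := transcendental_of_notMem_range hμ
  obtain ⟨h1, h2⟩ := laurent_adjoin_coeff_zero hM hμ'
  refine ⟨M.coeff 0, hμ', fun b hb => ?_⟩
  have hsub (x) (hx : x ∈ (Algebra.adjoin k {M, M⁻¹} : Subalgebra k (HahnSeries ℤ Ω))) :
      x ∈ Algebra.adjoin k ((Algebra.adjoin k {M, M⁻¹} : Subalgebra k (HahnSeries ℤ Ω)) ∪
        {ρ, ρ⁻¹} : Set (HahnSeries ℤ Ω)) := Algebra.subset_adjoin (Or.inl hx)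
  have hS' := hS (Algebra.adjoin k ((Algebra.adjoin k {M, M⁻¹} : Subalgebra k (HahnSeries ℤ Ω)) ∪
    {ρ, ρ⁻¹} : Set (HahnSeries ℤ Ω))) (Algebra.subset_adjoin (by simp))
    (Algebra.subset_adjoin (by simp)) (hsub _ (Algebra.subset_adjoin (by simp)))
    (hsub _ (Algebra.subset_adjoin (by simp)))
  obtain ⟨x, hx, h⟩ := exists_coeff_zero_eq_of_mem_orderClosure h1 hρ0 hρpos (hbnn b)
    (hmem _ (Algebra.subset_adjoin (by simp)) (Algebra.subset_adjoin (by simp)) hS'.1 hS'.2 b hb)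
  rw [← hb0 b, h]
  exact h2 x hx

end Generator

section Expansion

variable {k V : Type} [Field k] [CommRing V] [IsDomain V] [Algebra k V]

open PowerSeries in
/-- Power series expansion in a local parameter `ϖ` generating the kernel of `σ`. -/
lemma exists_powerSeries_expansion (σ : V →ₐ[k] k) {ϖ : V} (hϖ : ϖ ≠ 0)
    (hσ : ∀ z, σ z = 0 → ϖ ∣ z) :
    ∃ f : V →ₐ[k] PowerSeries k, (∀ z, constantCoeff (f z) = σ z) ∧
      ∀ z, f z = 0 → ∀ n, ϖ ^ n ∣ z := by
  have h (z : V) : ∃ d, z = algebraMap k V (σ z) + ϖ * d := by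
    obtain ⟨d, hd⟩ := hσ (z - algebraMap k V (σ z)) (by simp)
    exact ⟨d, by linear_combination hd⟩
  choose δ hδ using h
  have hadd (z w : V) : δ (z + w) = δ z + δ w := by
    apply mul_left_cancel₀ hϖ
    have := hδ (z + w)
    rw [map_add, map_add] at this
    linear_combination hδ z + hδ w - this
  have hconst (c : k) : δ (algebraMap k V c) = 0 := by
    apply mul_left_cancel₀ hϖ
    have := hδ (algebraMap k V c)
    rw [AlgHom.commutes] at this
    simp only [Algebra.algebraMap_self, RingHom.id_apply] at this
    linear_combination -this
  have hmul (z w : V) : δ (z * w) = δ z * w + algebraMap k V (σ z) * δ w := by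
    apply mul_left_cancel₀ hϖ
    have := hδ (z * w)
    rw [map_mul, map_mul] at this
    linear_combination w * hδ z + algebraMap k V (σ z) * hδ w - this
  let f (z : V) : PowerSeries k := PowerSeries.mk fun n => σ (δ^[n] z)
  have hf0 (z : V) : coeff 0 (f z) = σ z := by simp [f]
  have hfs (z : V) (n : ℕ) : coeff (n + 1) (f z) = coeff n (f (δ z)) := by
    simp [f, Function.iterate_succ_apply]
  have hf (z : V) : f z = C (σ z) + X * f (δ z) := by
    ext n
    cases n with
    | zero => rw [hf0]; simp
    | succ n => rw [hfs]; simp [coeff_succ_X_mul, coeff_succ_C]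
  have fadd (z w : V) : f (z + w) = f z + f w := by
    ext n
    induction n generalizing z w with
    | zero => rw [map_add, hf0, hf0, hf0, map_add]
    | succ n ih => rw [map_add, hfs, hfs, hfs, hadd, ih, map_add]
  have fzero : f 0 = 0 := by
    have := fadd 0 0
    rw [add_zero] at this
    exact left_eq_add.mp this
  have fconst (c : k) : f (algebraMap k V c) = C c := by
    rw [hf, hconst, fzero, AlgHom.commutes]
    simp
  have fmul (z w : V) : f (z * w) = f z * f w := by
    ext n
    induction n generalizing z w with
    | zero =>
      rw [hf0, map_mul, coeff_zero_eq_constantCoeff_apply, map_mul,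
        ← coeff_zero_eq_constantCoeff_apply, ← coeff_zero_eq_constantCoeff_apply, hf0, hf0]
    | succ n ih =>
      have h1 : coeff n (f (algebraMap k V (σ z) * δ w)) = coeff n (C (σ z) * f (δ w)) := by
        rw [ih, fconst]
      have h2 : f z * f w = C (σ z) * C (σ w) + X * (f (δ z) * f w + C (σ z) * f (δ w)) := by
        rw [hf z, hf w]
        ring
      rw [hfs, hmul, fadd, map_add, h1, ih, h2, ← map_mul, map_add, coeff_succ_C, zero_add,
        coeff_succ_X_mul, map_add]
  have fone : f 1 = 1 := by
    have := fconst 1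
    rwa [map_one, map_one] at this
  refine ⟨{ toFun := f, map_one' := fone, map_mul' := fmul, map_zero' := fzero, map_add' := fadd,
            commutes' := fconst }, fun z => ?_, fun z hz n => ?_⟩
  · rw [← coeff_zero_eq_constantCoeff_apply]
    exact hf0 z
  · change f z = 0 at hz
    induction n generalizing z with
    | zero => simp
    | succ n ih =>
      have h1 : σ z = 0 := by rw [← hf0, hz, map_zero]
      have h2 : f (δ z) = 0 := by
        ext n
        rw [← hfs, hz, map_zero, map_zero]
      obtain ⟨d, hd⟩ := ih _ h2
      refine ⟨d, ?_⟩
      rw [hδ z, h1, map_zero, hd]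
      ring

lemma residue_bijective_of_finiteType {k C : Type} [Field k] [IsAlgClosed k] [CommRing C]
    [Algebra k C] [Algebra.FiniteType k C] (M : Ideal C) [M.IsMaximal] :
    Function.Bijective (algebraMap k (C ⧸ M)) := by
  let : Field (C ⧸ M) := Ideal.Quotient.field M
  have : Module.Finite k (C ⧸ M) := finite_of_finite_type_of_isJacobsonRing k (C ⧸ M)
  exact IsAlgClosed.algebraMap_bijective_of_isIntegral

/-- The `k`-point attached to a maximal ideal. -/
lemma exists_algHom_ker_eq {k C : Type} [Field k] [IsAlgClosed k] [CommRing C]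
    [Algebra k C] [Algebra.FiniteType k C] (M : Ideal C) [M.IsMaximal] :
    ∃ σ : C →ₐ[k] k, ∀ z, σ z = 0 ↔ z ∈ M := by
  let e := AlgEquiv.ofBijective (Algebra.ofId k (C ⧸ M)) (residue_bijective_of_finiteType M)
  refine ⟨(e.symm : (C ⧸ M) →ₐ[k] k).comp (Ideal.Quotient.mkₐ k M), fun z => ?_⟩
  simp [Ideal.Quotient.eq_zero_iff_mem]

lemma exists_laurent_expansion {k C K : Type} [Field k] [IsAlgClosed k] [CommRing C]
    [IsDedekindDomain C] [Algebra k C] [Algebra.FiniteType k C] [Field K] [Algebra k K]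
    [Algebra C K] [IsScalarTower k C K] [IsFractionRing C K] (M : Ideal C) [hM : M.IsMaximal]
    {x : C} (hx0 : x ≠ 0) (hx : x ∈ M) :
    ∃ Q : K →ₐ[k] HahnSeries ℤ k, 0 < (Q (algebraMap C K x)).orderTop := by
  have hM0 : M ≠ ⊥ := by
    rintro rfl
    exact hx0 hx
  obtain ⟨σ, hσ⟩ := exists_algHom_ker_eq (k := k) M
  let V := Localization.AtPrime M
  have : IsDiscreteValuationRing V :=
    IsLocalization.AtPrime.isDiscreteValuationRing_of_dedekind_domain C hM0 V
  let τ : V →ₐ[k] k := IsLocalization.liftAlgHom (M := M.primeCompl) (f := σ) (fun y =>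
    isUnit_iff_ne_zero.mpr fun h => y.2 ((hσ _).mp h))
  have hτ (c : C) : τ (algebraMap C V c) = σ c := by
    simp [τ]
  obtain ⟨ϖ, hϖ⟩ := IsDiscreteValuationRing.exists_irreducible V
  have hmax := hϖ.maximalIdeal_eq
  have hτϖ : τ ϖ = 0 := by
    have : ϖ ∈ IsLocalRing.maximalIdeal V := by
      rw [hmax]
      exact Ideal.mem_span_singleton_self ϖ
    by_contra h
    have h1 : ϖ - algebraMap k V (τ ϖ) ∈ IsLocalRing.maximalIdeal V := by
      rw [IsLocalRing.mem_maximalIdeal]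
      intro hu
      have := hu.map τ
      simp at this
    have h2 := sub_mem this h1
    rw [sub_sub_cancel, IsLocalRing.mem_maximalIdeal] at h2
    exact h2 ((isUnit_iff_ne_zero.mpr h).map (algebraMap k V))
  obtain ⟨f, hf, hf'⟩ := exists_powerSeries_expansion τ hϖ.ne_zero (fun z hz => by
    rw [← Ideal.mem_span_singleton, ← hmax, IsLocalRing.mem_maximalIdeal]
    intro hu
    have := hu.map τ
    rw [hz] at this
    exact not_isUnit_zero this)
  have hfinj : Function.Injective f := by
    rw [injective_iff_map_eq_zero]
    intro z hz
    by_contra hz0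
    obtain ⟨n, u, rfl⟩ := IsDiscreteValuationRing.eq_unit_mul_pow_irreducible hz0 hϖ
    obtain ⟨d, hd⟩ := hf' _ hz (n + 1)
    have hd' : (u : V) = ϖ * d := by
      apply mul_right_cancel₀ (pow_ne_zero n hϖ.ne_zero)
      rw [hd]
      ring
    exact hϖ.not_isUnit (isUnit_of_mul_isUnit_left (hd' ▸ u.isUnit))
  let g : C →+* HahnSeries ℤ k :=
    (HahnSeries.ofPowerSeries ℤ k).comp ((f : V →+* PowerSeries k).comp (algebraMap C V))
  have hg : Function.Injective g :=
    HahnSeries.ofPowerSeries_injective.comp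
      (hfinj.comp (IsLocalization.injective V M.primeCompl_le_nonZeroDivisors))
  let Q : K →+* HahnSeries ℤ k := IsFractionRing.lift hg
  have hQ (c : C) : Q (algebraMap C K c) = g c := IsFractionRing.lift_algebraMap hg c
  refine ⟨{ Q with commutes' := fun c => ?_ }, ?_⟩
  · change Q (algebraMap k K c) = _
    rw [IsScalarTower.algebraMap_apply k C K, hQ]
    simp only [g, RingHom.comp_apply, RingHom.coe_coe]
    rw [← IsScalarTower.algebraMap_apply k C V]
    rw [f.commutes]
    exact HahnSeries.ofPowerSeries_C c
  · change 0 < (Q (algebraMap C K x)).orderTop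
    rw [hQ]
    refine lt_of_lt_of_le (b := ((1 : ℤ) : WithTop ℤ)) (by norm_cast) ?_
    rw [HahnSeries.le_orderTop_iff_forall]
    intro j hj
    have hj' : j < 1 := by exact_mod_cast hj
    change (((f (algebraMap C V x) : PowerSeries k) : LaurentSeries k)).coeff j = 0
    rcases (show j < 0 ∨ j = 0 by omega) with h | rfl
    · rw [PowerSeries.coeff_coe, if_pos h]
    · rw [PowerSeries.coeff_coe, if_neg (lt_irrefl _), Int.natAbs_zero,
        PowerSeries.coeff_zero_eq_constantCoeff_apply, hf, hτ, hσ]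
      exact hx

end Expansion

section Place

variable {k K : Type} [Field k] [Field K] [Algebra k K]

open IntermediateField.algebraAdjoinAdjoin in
/-- A nonconstant element of a curve field over an algebraically closed field of characteristic
zero has positive order in some Laurent series expansion. -/
lemma IsCurveField.exists_orderTop_pos [IsAlgClosed k] [CharZero k] [Algebra.EssFiniteType k K]
    (hK : IsCurveField k K) {x : K} (hx : x ∉ Set.range (algebraMap k K)) :
    ∃ Q : K →ₐ[k] HahnSeries ℤ k, 0 < (Q x).orderTop := by
  have htr : Transcendental k x := transcendental_of_notMem_range hx
  let : Algebra (Polynomial k) K := (Polynomial.aeval x).toAlgebra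
  have hmap (p : Polynomial k) : algebraMap (Polynomial k) K p = Polynomial.aeval x p := rfl
  have : IsScalarTower k (Polynomial k) K := IsScalarTower.of_algebraMap_eq fun c => by
    rw [hmap, Polynomial.algebraMap_eq, Polynomial.aeval_C]
  have hinj : Function.Injective (algebraMap (Polynomial k) K) :=
    transcendental_iff_injective.mp htr
  have : FaithfulSMul (Polynomial k) K := (faithfulSMul_iff_algebraMap_injective _ _).mpr hinj
  have : Algebra.IsAlgebraic (Polynomial k) K := ⟨fun w => by
    have h1 : IsAlgebraic (Algebra.adjoin k {x}) w :=
      (IsFractionRing.isAlgebraic_iff (Algebra.adjoin k {x}) (IntermediateField.adjoin k {x})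
        K).mpr (hK x w hx)
    let f : Polynomial k →ₐ[k] Algebra.adjoin k {x} :=
      (Polynomial.aeval x).codRestrict _ fun p => by
        rw [Algebra.adjoin_singleton_eq_range_aeval]
        exact ⟨p, rfl⟩
    refine IsAlgebraic.of_ringHom_of_comp_eq f (RingHom.id K) (a := w) h1 ?_
      Function.injective_id ?_
    · rintro ⟨y, hy⟩
      rw [Algebra.adjoin_singleton_eq_range_aeval] at hy
      obtain ⟨p, rfl⟩ := hy
      exact ⟨p, rfl⟩
    · ext <;> rfl⟩
  let : Algebra (FractionRing (Polynomial k)) K := FractionRing.liftAlgebra _ _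
  have : IsScalarTower (Polynomial k) (FractionRing (Polynomial k)) K := inferInstance
  have : IsScalarTower k (FractionRing (Polynomial k)) K :=
    IsScalarTower.of_algebraMap_eq fun c => by
      rw [IsScalarTower.algebraMap_apply k (Polynomial k) K,
        IsScalarTower.algebraMap_apply k (Polynomial k) (FractionRing (Polynomial k)),
        ← IsScalarTower.algebraMap_apply (Polynomial k) (FractionRing (Polynomial k)) K]
  have : Algebra.EssFiniteType (FractionRing (Polynomial k)) K := .of_comp k _ _
  have : Algebra.IsAlgebraic (FractionRing (Polynomial k)) K :=
    ⟨fun w => (IsFractionRing.isAlgebraic_iff (Polynomial k) (FractionRing (Polynomial k)) K).mp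
      (Algebra.IsAlgebraic.isAlgebraic w)⟩
  have : Module.Finite (FractionRing (Polynomial k)) K :=
    Algebra.finite_of_essFiniteType_of_isAlgebraic
  let C := integralClosure (Polynomial k) K
  have : IsDedekindDomain C := integralClosure.isDedekindDomain_fractionRing (Polynomial k) K
  have : IsFractionRing C K := integralClosure.isFractionRing_of_algebraic fun p hp =>
    hinj (hp.trans (map_zero _).symm)
  have : Module.Finite (Polynomial k) C :=
    IsIntegralClosure.finite (Polynomial k) (FractionRing (Polynomial k)) K C
  have : Algebra.FiniteType k C := .trans (S := Polynomial k) inferInstance inferInstance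
  have hX : (Ideal.span {(Polynomial.X : Polynomial k)}).IsMaximal :=
    PrincipalIdealRing.isMaximal_of_irreducible Polynomial.irreducible_X
  obtain ⟨M, hM, hMX⟩ := Ideal.exists_ideal_over_maximal_of_isIntegral (S := C)
    (Ideal.span {(Polynomial.X : Polynomial k)}) (by
      rw [(RingHom.injective_iff_ker_eq_bot (algebraMap (Polynomial k) C)).mp
        (FaithfulSMul.algebraMap_injective _ _)]
      exact bot_le)
  have hxM : algebraMap (Polynomial k) C Polynomial.X ∈ M := by
    rw [← Ideal.mem_comap, hMX]
    exact Ideal.mem_span_singleton_self _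
  have hx0 : algebraMap (Polynomial k) C Polynomial.X ≠ 0 := by
    rw [Ne, FaithfulSMul.algebraMap_eq_zero_iff]
    exact Polynomial.X_ne_zero
  obtain ⟨Q, hQ⟩ := exists_laurent_expansion (k := k) (K := K) M hx0 hxM
  refine ⟨Q, ?_⟩
  have : algebraMap C K (algebraMap (Polynomial k) C Polynomial.X) = x := by
    rw [← IsScalarTower.algebraMap_apply (Polynomial k) C K, hmap, Polynomial.aeval_X]
  rwa [this] at hQ

/-- A nonconstant element of a curve field has a pole in some Laurent series expansion. -/
lemma IsCurveField.exists_orderTop_neg [IsAlgClosed k] [CharZero k] [Algebra.EssFiniteType k K]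
    (hK : IsCurveField k K) {x : K} (hx : x ∉ Set.range (algebraMap k K)) :
    ∃ Q : K →ₐ[k] HahnSeries ℤ k, (Q x).orderTop < 0 := by
  have hx' : x⁻¹ ∉ Set.range (algebraMap k K) := by
    rintro ⟨c, hc⟩
    exact hx ⟨c⁻¹, by rw [map_inv₀, hc, inv_inv]⟩
  obtain ⟨Q, hQ⟩ := hK.exists_orderTop_pos hx'
  refine ⟨Q, ?_⟩
  have hx0 : x ≠ 0 := by
    rintro rfl
    exact hx ⟨0, map_zero _⟩
  obtain ⟨q, hq⟩ := exists_int_eq_orderTop ((map_ne_zero Q).mpr hx0)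
  have h := orderTop_zpow_int hq (-1)
  rw [zpow_neg_one, ← map_inv₀] at h
  rw [h] at hQ
  rw [hq]
  have : 0 < -1 * q := by exact_mod_cast hQ
  have : q < 0 := by omega
  exact_mod_cast this

end Place

section SeriesOfTensor

variable {k B Ω : Type} [Field k] [CommRing B] [Algebra k B] [Field Ω] [Algebra k Ω]
  [Algebra B Ω] [IsScalarTower k B Ω]

/-- Extension of coefficients in a series expansion. -/
noncomputable def mapCoeff (Q : B →ₐ[k] HahnSeries ℤ k) : B →ₐ[k] HahnSeries ℤ Ω where
  toFun b := (Q b).map (algebraMap k Ω)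
  map_one' := by
    rw [map_one]
    exact HahnSeries.map_one (algebraMap k Ω).toMonoidWithZeroHom
  map_mul' x y := by
    rw [map_mul]
    exact HahnSeries.map_mul (algebraMap k Ω : k →ₙ+* Ω)
  map_zero' := by
    rw [map_zero]
    exact HahnSeries.map_zero (algebraMap k Ω : ZeroHom k Ω)
  map_add' x y := by
    rw [map_add]
    exact HahnSeries.map_add (algebraMap k Ω : k →+ Ω)
  commutes' c := by
    rw [Q.commutes]
    exact HahnSeries.map_C c (algebraMap k Ω)

/-- The homomorphism sending `b ⊗ c` to `b` times the series expansion of `c`. -/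
noncomputable def tensorSeries (Ω : Type) [Field Ω] [Algebra k Ω] [Algebra B Ω]
    [IsScalarTower k B Ω] (Q : B →ₐ[k] HahnSeries ℤ k) : B ⊗[k] B →ₐ[k] HahnSeries ℤ Ω :=
  Algebra.TensorProduct.productMap
    ((Algebra.ofId Ω (HahnSeries ℤ Ω)).restrictScalars k |>.comp (IsScalarTower.toAlgHom k B Ω))
    (mapCoeff Q)

/-- The coefficient functionals of a series expansion. -/
noncomputable def coeffFunctional (Q : B →ₐ[k] HahnSeries ℤ k) (n : ℤ) : B →ₗ[k] k where
  toFun b := (Q b).coeff n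
  map_add' x y := by rw [map_add, HahnSeries.coeff_add]
  map_smul' c x := by
    rw [map_smul]
    rfl

lemma coeff_tensorSeries (Q : B →ₐ[k] HahnSeries ℤ k) (n : ℤ) (t : B ⊗[k] B) :
    (tensorSeries Ω Q t).coeff n =
      algebraMap B Ω (TensorProduct.rid k B ((coeffFunctional Q n).lTensor B t)) := by
  induction t using TensorProduct.induction_on with
  | zero => simp
  | add x y hx hy => simp only [map_add, HahnSeries.coeff_add, hx, hy]
  | tmul b c =>
    rw [tensorSeries, Algebra.TensorProduct.productMap_apply_tmul, LinearMap.lTensor_tmul,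
      TensorProduct.rid_tmul, Algebra.smul_def, map_mul, ← IsScalarTower.algebraMap_apply, mul_comm]
    refine Eq.trans ?_ (mul_comm _ _)
    rw [mul_comm]
    exact HahnSeries.coeff_single_zero_mul

lemma tensorSeries_injective (hB : Function.Injective (algebraMap B Ω))
    {Q : B →ₐ[k] HahnSeries ℤ k} (hQ : Function.Injective Q) :
    Function.Injective (tensorSeries Ω Q) := by
  rw [injective_iff_map_eq_zero]
  intro t ht
  let β := Module.Basis.ofVectorSpace k B
  classical
  apply (TensorProduct.equivFinsuppOfBasisLeft β).injective
  rw [map_zero]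
  ext i
  apply hQ
  ext n
  rw [Finsupp.zero_apply, map_zero, HahnSeries.coeff_zero]
  have h1 : TensorProduct.rid k B ((coeffFunctional Q n).lTensor B t) = 0 := by
    apply hB
    rw [← coeff_tensorSeries, ht, map_zero, HahnSeries.coeff_zero]
  have h2 (t : B ⊗[k] B) : coeffFunctional Q n (TensorProduct.equivFinsuppOfBasisLeft β t i) =
      β.repr (TensorProduct.rid k B ((coeffFunctional Q n).lTensor B t)) i := by
    induction t using TensorProduct.induction_on with
    | zero => simp
    | add x y hx hy => simp only [map_add, Finsupp.add_apply, hx, hy]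
    | tmul b c =>
      rw [TensorProduct.equivFinsuppOfBasisLeft_apply_tmul_apply, LinearMap.lTensor_tmul,
        TensorProduct.rid_tmul, map_smul, map_smul, Finsupp.smul_apply, smul_eq_mul, smul_eq_mul,
        mul_comm]
  have h3 := h2 t
  rw [h1, map_zero, Finsupp.zero_apply] at h3
  exact h3

end SeriesOfTensor

section Dichotomy

variable {k A B : Type} [Field k] [CommRing A] [CommRing B] [Algebra k A] [Algebra k B]

/-- An injective homomorphism inducing an isomorphism of fraction fields (of domains). -/
def IsBirationalHom (α : A →ₐ[k] B) : Prop :=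
  Function.Injective α ∧ ∀ b, ∃ a₁ a₂, a₂ ≠ 0 ∧ α a₂ * b = α a₁

/-- The algebra embeds in the ring of Laurent polynomials. -/
def IsLaurentish (k B : Type) [Field k] [CommRing B] [Algebra k B] : Prop :=
  ∃ ψ : B →ₐ[k] RatFunc k, Function.Injective ψ ∧
    ∀ b, ∃ (p : Polynomial k) (n : ℕ), ψ b * RatFunc.X ^ n = algebraMap _ _ p

lemma isLaurentish_of_mem_adjoin {Ω : Type} [Field Ω] [Algebra k Ω] (θ : B →ₐ[k] Ω)
    (hθ : Function.Injective θ) {μ : Ω} (hμ : Transcendental k μ)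
    (h : ∀ b, θ b ∈ Algebra.adjoin k {μ, μ⁻¹}) : IsLaurentish k B := by
  have hμ0 : μ ≠ 0 := by
    rintro rfl
    exact hμ isAlgebraic_zero
  have h' : ∀ x ∈ Algebra.adjoin k {μ, μ⁻¹}, ∃ (p : Polynomial k) (n : ℕ),
      x * μ ^ n = Polynomial.aeval μ p := by
    intro x hx
    induction hx using Algebra.adjoin_induction with
    | mem x hx =>
      obtain rfl | rfl := hx
      · exact ⟨Polynomial.X, 0, by simp⟩
      · exact ⟨1, 1, by simp [hμ0]⟩
    | algebraMap c => exact ⟨Polynomial.C c, 0, by simp⟩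
    | add x y _ _ hx hy =>
      obtain ⟨p, n, hp⟩ := hx
      obtain ⟨q, m, hq⟩ := hy
      refine ⟨p * Polynomial.X ^ m + q * Polynomial.X ^ n, n + m, ?_⟩
      simp only [map_add, map_mul, map_pow, Polynomial.aeval_X, ← hp, ← hq]
      ring
    | mul x y _ _ hx hy =>
      obtain ⟨p, n, hp⟩ := hx
      obtain ⟨q, m, hq⟩ := hy
      refine ⟨p * q, n + m, ?_⟩
      simp only [map_mul, ← hp, ← hq]
      ring
  let E := RatFunc.algEquivOfTranscendental μ hμ
  have hmem (b : B) : θ b ∈ (IntermediateField.adjoin k {μ}).toSubalgebra := by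
    refine (Algebra.adjoin_le ?_) (h b)
    have := IntermediateField.mem_adjoin_simple_self k μ
    rintro _ (rfl | rfl)
    · exact this
    · exact (IntermediateField.adjoin k {μ}).inv_mem this
  let θ' : B →ₐ[k] IntermediateField.adjoin k {μ} := θ.codRestrict _ hmem
  refine ⟨(E.symm : _ →ₐ[k] RatFunc k).comp θ', ?_, fun b => ?_⟩
  · intro x y hxy
    have : θ' x = θ' y := E.symm.injective hxy
    exact hθ (congrArg Subtype.val this)
  · obtain ⟨p, n, hp⟩ := h' _ (h b)
    refine ⟨p, n, ?_⟩
    apply E.injective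
    rw [map_mul, map_pow]
    change E (E.symm (θ' b)) * _ = _
    rw [E.apply_symm_apply]
    apply Subtype.ext
    rw [IntermediateField.coe_mul, IntermediateField.coe_pow, RatFunc.algEquivOfTranscendental_X,
      RatFunc.algEquivOfTranscendental_algebraMap]
    change θ b * μ ^ n = _
    rw [hp]
    simp

variable [IsDomain A]

lemma exists_isBirationalHom_of_trivial {K Ω : Type} [Field K] [Field Ω] [Algebra k K]
    [Algebra k Ω] [Algebra A K] [IsScalarTower k A K] [IsFractionRing A K]
    [Algebra B Ω] [IsScalarTower k B Ω] (hBΩ : Function.Injective (algebraMap B Ω))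
    (hk : IsAlgClosed k) (hK : IsCurveField k K) (φ₁ φ₂ : K →ₐ[k] HahnSeries ℤ Ω)
    (h₁ : ∀ z ≠ 0, (φ₁ z).orderTop = 0) (h₂ : ∃ z ≠ 0, (φ₂ z).orderTop ≠ 0)
    (hA : ∀ a : A, ∃ b : B, (φ₁ (algebraMap A K a)).coeff 0 = algebraMap B Ω b)
    (hB : ∀ b : B, HahnSeries.C (algebraMap B Ω b) ∈
      Algebra.adjoin k (Set.range φ₁ ∪ Set.range φ₂)) :
    ∃ α : A →ₐ[k] B, IsBirationalHom α := by
  have hR : ∀ x ∈ φ₁.range, 0 ≤ x.orderTop := by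
    rintro _ ⟨z, rfl⟩
    by_cases hz : z = 0
    · simp [hz]
    · exact (h₁ z hz).ge
  let θ : K →ₐ[k] Ω := (coeffZeroHom φ₁.range hR).comp φ₁.rangeRestrict
  have hθ (z : K) : θ z = (φ₁ z).coeff 0 := rfl
  let ι : B →ₐ[k] Ω := IsScalarTower.toAlgHom k B Ω
  let j : B ≃ₐ[k] ι.range := AlgEquiv.ofInjective ι hBΩ
  let α₀ : A →ₐ[k] ι.range := (θ.comp (IsScalarTower.toAlgHom k A K)).codRestrict _ fun a => by
    obtain ⟨b, hb⟩ := hA a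
    exact ⟨b, hb.symm⟩
  let α : A →ₐ[k] B := (j.symm : ι.range →ₐ[k] B).comp α₀
  have hα (a : A) : algebraMap B Ω (α a) = θ (algebraMap A K a) := by
    have : j (α a) = α₀ a := j.apply_symm_apply _
    exact congrArg Subtype.val this
  refine ⟨α, ?_, fun b => ?_⟩
  · intro x y hxy
    have := congrArg (algebraMap B Ω) hxy
    rw [hα, hα] at this
    exact IsFractionRing.injective A K (θ.toRingHom.injective this)
  · obtain ⟨z, hz⟩ := mem_range_coeff_zero_of_trivial hk hK φ₁ φ₂ h₁ h₂ (hB b)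
    obtain ⟨a₁, a₂, ha₂, rfl⟩ := IsFractionRing.div_surjective (A := A) z
    refine ⟨a₁, a₂, nonZeroDivisors.ne_zero ha₂, ?_⟩
    apply hBΩ
    rw [map_mul, hα, hα, hz, ← hθ, ← map_mul, mul_div_cancel₀]
    exact IsFractionRing.to_map_ne_zero_of_mem_nonZeroDivisors ha₂

end Dichotomy

section MainDichotomy

variable {k A B : Type} [Field k] [IsAlgClosed k] [CharZero k] [CommRing A] [CommRing B]
  [Algebra k A] [Algebra k B] [IsDomain A] [IsDomain B] [Algebra.FiniteType k B]

lemma exists_isBirationalHom_or_isLaurentish (hA : IsCurveField k (FractionRing A))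
    (hB : IsCurveField k (FractionRing B)) {b : B} (hb : b ∉ Set.range (algebraMap k B))
    (e : A ⊗[k] A ≃ₐ[k] B ⊗[k] B) :
    (∃ α : A →ₐ[k] B, IsBirationalHom α) ∨ IsLaurentish k B := by
  have hk : IsAlgClosed k := inferInstance
  let K := FractionRing A
  let Ω := AlgebraicClosure (FractionRing B)
  have : IsScalarTower k B Ω := .of_algebraMap_eq fun c => by
    rw [IsScalarTower.algebraMap_apply k (FractionRing B) Ω,
      IsScalarTower.algebraMap_apply k B (FractionRing B),
      ← IsScalarTower.algebraMap_apply B (FractionRing B) Ω]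
  have hBΩ : Function.Injective (algebraMap B Ω) := by
    rw [IsScalarTower.algebraMap_eq B (FractionRing B) Ω]
    exact (algebraMap (FractionRing B) Ω).injective.comp (IsFractionRing.injective B _)
  have : CharZero Ω := charZero_of_injective_algebraMap (algebraMap k Ω).injective
  have : Algebra.EssFiniteType k (FractionRing B) := .comp k B _
  have hb' : algebraMap B (FractionRing B) b ∉ Set.range (algebraMap k (FractionRing B)) := by
    rintro ⟨c, hc⟩
    refine hb ⟨c, IsFractionRing.injective B (FractionRing B) ?_⟩
    rw [← hc, ← IsScalarTower.algebraMap_apply]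
  obtain ⟨Q', hQ'⟩ := hB.exists_orderTop_neg hb'
  let Q : B →ₐ[k] HahnSeries ℤ k := Q'.comp (IsScalarTower.toAlgHom k B (FractionRing B))
  have hQb : (Q b).orderTop < 0 := hQ'
  have hQ : Function.Injective Q :=
    Q'.toRingHom.injective.comp (IsFractionRing.injective B (FractionRing B))
  let Ψ := tensorSeries Ω Q
  have hΨ : Function.Injective Ψ := tensorSeries_injective hBΩ hQ
  let i₁ : A →ₐ[k] HahnSeries ℤ Ω :=
    (Ψ.comp (e : A ⊗[k] A →ₐ[k] B ⊗[k] B)).comp Algebra.TensorProduct.includeLeft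
  let i₂ : A →ₐ[k] HahnSeries ℤ Ω :=
    (Ψ.comp (e : A ⊗[k] A →ₐ[k] B ⊗[k] B)).comp Algebra.TensorProduct.includeRight
  have hi₁ : Function.Injective i₁ := (hΨ.comp e.injective).comp
    (Algebra.TensorProduct.includeLeft_injective (S := k) (algebraMap k A).injective)
  have hi₂ : Function.Injective i₂ := (hΨ.comp e.injective).comp
    (Algebra.TensorProduct.includeRight_injective (algebraMap k A).injective)
  let φ₁ : K →ₐ[k] HahnSeries ℤ Ω := IsFractionRing.liftAlgHom hi₁
  let φ₂ : K →ₐ[k] HahnSeries ℤ Ω := IsFractionRing.liftAlgHom hi₂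
  have hφ₁ (a : A) : φ₁ (algebraMap A K a) = Ψ (e (a ⊗ₜ 1)) :=
    IsFractionRing.lift_algebraMap (g := i₁.toRingHom) hi₁ a
  have hφ₂ (a : A) : φ₂ (algebraMap A K a) = Ψ (e (1 ⊗ₜ a)) :=
    IsFractionRing.lift_algebraMap (g := i₂.toRingHom) hi₂ a
  have hrange (t : B ⊗[k] B) : Ψ t ∈ Algebra.adjoin k (Set.range φ₁ ∪ Set.range φ₂) := by
    obtain ⟨s, rfl⟩ := e.surjective t
    induction s using TensorProduct.induction_on with
    | zero => simp
    | add x y hx hy =>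
      rw [map_add, map_add]
      exact add_mem hx hy
    | tmul x y =>
      have : x ⊗ₜ[k] y = (x ⊗ₜ 1) * (1 ⊗ₜ y) := by simp
      rw [this, map_mul, map_mul, ← hφ₁, ← hφ₂]
      exact mul_mem (Algebra.subset_adjoin (Or.inl ⟨_, rfl⟩))
        (Algebra.subset_adjoin (Or.inr ⟨_, rfl⟩))
  have hC (c : B) : Ψ (c ⊗ₜ 1) = HahnSeries.C (algebraMap B Ω c) := by
    change tensorSeries Ω Q (c ⊗ₜ 1) = _
    rw [tensorSeries, Algebra.TensorProduct.productMap_left_apply]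
    rfl
  have hBmem (c : B) : HahnSeries.C (algebraMap B Ω c) ∈
      Algebra.adjoin k (Set.range φ₁ ∪ Set.range φ₂) := hC c ▸ hrange _
  have hcoeff (t : B ⊗[k] B) : ∃ c : B, (Ψ t).coeff 0 = algebraMap B Ω c :=
    ⟨_, coeff_tensorSeries Q 0 t⟩
  by_cases h₁ : ∃ z ≠ 0, (φ₁ z).orderTop ≠ 0
  · by_cases h₂ : ∃ z ≠ 0, (φ₂ z).orderTop ≠ 0
    · right
      obtain ⟨μ, hμ, h⟩ := exists_laurent_generator hk hA φ₁ φ₂ h₁ h₂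
        (B := Set.range (algebraMap B Ω)) (by rintro _ ⟨c, rfl⟩; exact hBmem c)
        ⟨_, ⟨b, rfl⟩, by
          rintro ⟨c, hc⟩
          refine hb ⟨c, hBΩ ?_⟩
          rw [← hc, ← IsScalarTower.algebraMap_apply]⟩
      exact isLaurentish_of_mem_adjoin (IsScalarTower.toAlgHom k B Ω) hBΩ hμ
        fun c => h _ ⟨c, rfl⟩
    · left
      push Not at h₂
      exact exists_isBirationalHom_of_trivial (K := K) hBΩ hk hA φ₂ φ₁ h₂ h₁
        (fun a => hφ₂ a ▸ hcoeff _) (fun c => Set.union_comm (Set.range φ₁) _ ▸ hBmem c)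
  · push Not at h₁
    by_cases h₂ : ∃ z ≠ 0, (φ₂ z).orderTop ≠ 0
    · left
      exact exists_isBirationalHom_of_trivial (K := K) hBΩ hk hA φ₁ φ₂ h₁ h₂
        (fun a => hφ₁ a ▸ hcoeff _) hBmem
    · push Not at h₂
      have h : Ψ (1 ⊗ₜ b) ∈ integralSeries k Ω := by
        refine Algebra.adjoin_le ?_ (hrange _)
        rintro _ (⟨z, rfl⟩ | ⟨z, rfl⟩)
        · by_cases hz : z = 0
          · rw [hz, map_zero]
            exact zero_mem _
          · exact (h₁ z hz).ge
        · by_cases hz : z = 0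
          · rw [hz, map_zero]
            exact zero_mem _
          · exact (h₂ z hz).ge
      have h' : (0 : WithTop ℤ) ≤ (Ψ (1 ⊗ₜ b)).orderTop := h
      obtain ⟨q, hq⟩ := exists_int_eq_orderTop (x := Q b) fun h0 => by
        rw [h0, HahnSeries.orderTop_zero] at hQb
        exact not_top_lt hQb
      have hne : (Q b).coeff q ≠ 0 := HahnSeries.coeff_orderTop_ne hq
      have hz : (Ψ (1 ⊗ₜ b)).coeff q = 0 := by
        apply HahnSeries.coeff_eq_zero_of_lt_orderTop
        refine lt_of_lt_of_le ?_ h'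
        rw [← hq]
        exact hQb
      change (tensorSeries Ω Q (1 ⊗ₜ b)).coeff q = 0 at hz
      rw [coeff_tensorSeries, LinearMap.lTensor_tmul, TensorProduct.rid_tmul, Algebra.smul_def,
        mul_one, ← IsScalarTower.algebraMap_apply, map_eq_zero] at hz
      exact absurd hz hne

end MainDichotomy

section SmoothNormal

lemma isAlgebraic_of_etale (R S : Type) [CommRing R] [IsDomain R] [CommRing S] [Algebra R S]
    [Algebra.Etale R S] : Algebra.IsAlgebraic R S := by
  let K := FractionRing R
  have : Module.Finite K (K ⊗[R] S) := Algebra.FormallyUnramified.finite_of_free K (K ⊗[R] S)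
  have hinj : Function.Injective (Algebra.TensorProduct.includeRight : S →ₐ[R] K ⊗[R] S) :=
    Algebra.TensorProduct.includeRight_injective (IsFractionRing.injective R K)
  refine ⟨fun s => ?_⟩
  rw [← isAlgebraic_algHom_iff _ hinj]
  exact (IsFractionRing.isAlgebraic_iff R K (K ⊗[R] S)).mpr (Algebra.IsAlgebraic.isAlgebraic _)

lemma isIntegrallyClosed_of_etale (R S : Type) [CommRing R] [IsDomain R] [IsIntegrallyClosed R]
    [CommRing S] [IsDomain S] [Algebra R S] [Algebra.Etale R S] : IsIntegrallyClosed S := by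
  let K := FractionRing R
  have := isAlgebraic_of_etale R S
  have : Module.IsTorsionFree R S := inferInstance
  have : IsFractionRing S (S ⊗[R] K) := by
    have h₁ : IsLocalization (Algebra.algebraMapSubmonoid S (nonZeroDivisors R)) (S ⊗[R] K) :=
      inferInstance
    have h₂ : IsLocalization (Algebra.algebraMapSubmonoid S (nonZeroDivisors R))
      (FractionRing S) := inferInstance
    exact IsLocalization.isLocalization_of_algEquiv (nonZeroDivisors S)
      (IsLocalization.algEquiv (Algebra.algebraMapSubmonoid S (nonZeroDivisors R))
        (FractionRing S) (S ⊗[R] K))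
  rw [isIntegrallyClosed_iff (S ⊗[R] K)]
  intro x hx
  obtain ⟨t, ht⟩ := (TensorProduct.toIntegralClosure_bijective_of_smooth (R := R) (S := S)
    (B := K)).2 ⟨x, hx⟩
  have ht' : (TensorProduct.toIntegralClosure R S K t : S ⊗[R] K) = x := congrArg Subtype.val ht
  rw [← ht']
  clear ht ht' hx x
  induction t using TensorProduct.induction_on with
  | zero => exact ⟨0, by simp⟩
  | add x y hx hy =>
    obtain ⟨u, hu⟩ := hx
    obtain ⟨v, hv⟩ := hy
    exact ⟨u + v, by rw [map_add, hu, hv, map_add]; rfl⟩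
  | tmul s c =>
    obtain ⟨r, hr⟩ := (isIntegrallyClosed_iff K).mp (inferInstanceAs (IsIntegrallyClosed R)) c.2
    refine ⟨r • s, ?_⟩
    change (r • s) ⊗ₜ[R] (1 : K) = s ⊗ₜ (c : K)
    rw [TensorProduct.smul_tmul, ← hr, Algebra.algebraMap_eq_smul_one]

lemma isIntegrallyClosed_of_exists_away {A : Type} [CommRing A] [IsDomain A]
    (h : ∀ m : Ideal A, m.IsMaximal → ∃ f ∉ m, IsIntegrallyClosed (Localization.Away f)) :
    IsIntegrallyClosed A := by
  choose f hf hf' using fun m : MaximalSpectrum A => h m.asIdeal m.isMaximal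
  have hf0 (m) : Submonoid.powers (f m) ≤ nonZeroDivisors A := by
    apply powers_le_nonZeroDivisors_of_noZeroDivisors
    intro h0
    exact hf m (h0 ▸ zero_mem _)
  refine IsIntegrallyClosed.of_localization_submonoid (fun m => Submonoid.powers (f m)) hf0 hf' ?_
  rw [eq_bot_iff, ← MaximalSpectrum.iInf_localization_eq_bot A (FractionRing A)]
  refine iInf_mono fun m => ?_
  rw [← Localization.subalgebra.ofField_eq]
  rintro x ⟨a, s, hs, rfl⟩
  refine ⟨a, s, ?_, rfl⟩
  have : m.asIdeal.IsPrime := m.isMaximal.isPrime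
  exact (Submonoid.powers_le.mpr (show f m ∈ m.asIdeal.primeCompl from hf m)) hs

lemma isIntegrallyClosed_of_smooth (k A : Type) [Field k] [CommRing A] [IsDomain A] [Algebra k A]
    [Algebra.Smooth k A] : IsIntegrallyClosed A := by
  refine isIntegrallyClosed_of_exists_away fun m hm => ?_
  obtain ⟨f, hfm, n, _, _, _⟩ :=
    Algebra.IsSmoothAt.exists_isStandardEtale_mvPolynomial (R := k) (p := m)
  have : IsDomain (Localization.Away f) := by
    apply IsLocalization.isDomain_localization
    apply powers_le_nonZeroDivisors_of_noZeroDivisors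
    rintro rfl
    exact hfm (zero_mem _)
  exact ⟨f, hfm, isIntegrallyClosed_of_etale (MvPolynomial (Fin n) k) _⟩

end SmoothNormal

section DimensionOne

lemma krullDimLE_one_of_isIntegral {R A : Type} [CommRing R] [CommRing A] [IsDomain R] [IsDomain A]
    [Algebra R A]
    [Algebra.IsIntegral R A] (hinj : Function.Injective (algebraMap R A))
    (hA : Ring.KrullDimLE 1 A) : Ring.KrullDimLE 1 R := by
  refine .mk₁' fun P hP hP' => ?_
  obtain ⟨Q, -, hQ, hQP⟩ := Ideal.exists_ideal_over_prime_of_isIntegral P (⊥ : Ideal A)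
    (by rw [← RingHom.ker_eq_comap_bot, (RingHom.injective_iff_ker_eq_bot _).mp hinj]; exact bot_le)
  have hQ0 : Q ≠ ⊥ := by
    rintro rfl
    apply hP
    rw [← hQP, ← RingHom.ker_eq_comap_bot, (RingHom.injective_iff_ker_eq_bot _).mp hinj]
  have := hQ.isMaximal_of_ne_bot hQ0
  rw [← hQP]
  exact Ideal.isMaximal_comap_of_isIntegral_of_isMaximal Q

variable {k A : Type} [Field k] [CommRing A] [IsDomain A] [Algebra k A] [Algebra.FiniteType k A]

lemma trdeg_le_one (hA : Ring.KrullDimLE 1 A) : Algebra.trdeg k A ≤ 1 := by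
  obtain ⟨s, g, hg, hg'⟩ := exists_integral_inj_algHom_of_fg k A
  let _ : Algebra (MvPolynomial (Fin s) k) A := g.toRingHom.toAlgebra
  have : IsScalarTower k (MvPolynomial (Fin s) k) A := .of_algebraMap_eq' g.comp_algebraMap.symm
  have : Algebra.IsIntegral (MvPolynomial (Fin s) k) A := ⟨hg'⟩
  have h1 := krullDimLE_one_of_isIntegral (R := MvPolynomial (Fin s) k) (A := A) hg hA
  rw [Ring.krullDimLE_iff, MvPolynomial.ringKrullDim_of_isNoetherianRing,
    ringKrullDim_eq_zero_of_field, zero_add, Nat.card_fin, Nat.cast_le] at h1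
  have : FaithfulSMul (MvPolynomial (Fin s) k) A :=
    (faithfulSMul_iff_algebraMap_injective _ _).mpr hg
  have h2 := trdeg_add_eq k (MvPolynomial (Fin s) k) (A := A)
  rw [trdeg_eq_zero (R := MvPolynomial (Fin s) k) (A := A), add_zero,
    MvPolynomial.trdeg_of_isDomain] at h2
  rw [← h2]
  simpa using h1

lemma isCurveField_fractionRing [IsAlgClosed k] (hA : Ring.KrullDimLE 1 A) :
    IsCurveField k (FractionRing A) := by
  intro z w hz
  have h1 : Algebra.trdeg k (FractionRing A) ≤ 1 := by
    have := IsLocalization.isAlgebraic (FractionRing A) (nonZeroDivisors A)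
    rw [← trdeg_add_eq k A (A := FractionRing A), trdeg_eq_zero (R := A) (A := FractionRing A),
      add_zero]
    exact trdeg_le_one hA
  have h2 : AlgebraicIndependent k (fun _ : Unit => z) :=
    algebraicIndependent_unique_type_iff.mpr (transcendental_of_notMem_range hz)
  have h3 := h2.isTranscendenceBasis_of_trdeg_le_of_finite (by simpa using h1)
  have h4 := h3.isAlgebraic_field
  rw [Set.range_const] at h4
  exact h4.isAlgebraic w

omit [Algebra.FiniteType k A] in
lemma exists_notMem_range [IsAlgClosed k] (hA : ringKrullDim A = 1) :
    ∃ a : A, a ∉ Set.range (algebraMap k A) := by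
  by_contra! h
  have : ringKrullDim k = ringKrullDim A :=
    ringKrullDim_eq_of_ringEquiv (RingEquiv.ofBijective (algebraMap k A)
      ⟨(algebraMap k A).injective, h⟩)
  rw [ringKrullDim_eq_zero_of_field, hA] at this
  exact zero_ne_one this

lemma isDedekindDomain_of_smooth (k : Type) [Field k] {A : Type} [CommRing A] [IsDomain A]
    [Algebra k A]
    [Algebra.FiniteType k A] [Algebra.Smooth k A] (hA : Ring.KrullDimLE 1 A) :
    IsDedekindDomain A := by
  have := isIntegrallyClosed_of_smooth k A
  have := Algebra.FiniteType.isNoetherianRing k A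
  have : Ring.DimensionLEOne A := ⟨fun h h' => h'.isMaximal_of_ne_bot h⟩
  exact {}

/-- A homomorphism from a curve whose image is not constant is injective. -/
lemma injective_of_notMem_range [IsAlgClosed k] (hA : Ring.KrullDimLE 1 A)
    {B : Type} [CommRing B] [IsDomain B] [Algebra k B] (f : A →ₐ[k] B) {a : A}
    (ha : f a ∉ Set.range (algebraMap k B)) : Function.Injective f := by
  by_contra h
  rw [← AlgHom.coe_toRingHom, RingHom.injective_iff_ker_eq_bot] at h
  have hp : (RingHom.ker f).IsPrime := RingHom.ker_isPrime _
  have hm : (RingHom.ker f).IsMaximal := hp.isMaximal_of_ne_bot h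
  obtain ⟨σ, hσ⟩ := exists_algHom_ker_eq (k := k) (RingHom.ker f)
  apply ha
  refine ⟨σ a, ?_⟩
  have : a - algebraMap k A (σ a) ∈ RingHom.ker f := by
    rw [← hσ]
    simp
  rw [RingHom.mem_ker, map_sub, sub_eq_zero] at this
  rw [this, AlgHom.commutes]

/-- In a Dedekind domain, divisibility is total locally at every maximal ideal. -/
lemma exists_dvd_mul_or_dvd_mul {A : Type} [CommRing A] [IsDedekindDomain A] (a b : A)
    (m : Ideal A) [m.IsMaximal] :
    ∃ s ∉ m, a ∣ b * s ∨ b ∣ a * s := by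
  by_cases hm : m = ⊥
  · subst hm
    rcases eq_or_ne a 0 with rfl | ha
    · exact ⟨1, by simp, .inr (by simp)⟩
    · exact ⟨a, by simpa using ha, .inl (dvd_mul_left a b)⟩
  have hv : ∀ x y : Localization.AtPrime m, x ∣ y ∨ y ∣ x := by
    have := IsLocalization.AtPrime.isDiscreteValuationRing_of_dedekind_domain A hm
      (Localization.AtPrime m)
    exact fun x y => ValuationRing.dvd_total x y
  have key : ∀ x y : A, algebraMap A (Localization.AtPrime m) x ∣ algebraMap _ _ y →
      ∃ s ∉ m, x ∣ y * s := by
    rintro x y ⟨c, hc⟩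
    obtain ⟨⟨d, s⟩, hs⟩ := IsLocalization.surj m.primeCompl c
    refine ⟨s, s.2, d, ?_⟩
    apply IsLocalization.injective (Localization.AtPrime m) m.primeCompl_le_nonZeroDivisors
    simp only [map_mul, hc, ← hs]
    ring
  rcases hv (algebraMap _ _ a) (algebraMap _ _ b) with h | h
  · obtain ⟨s, hs, h⟩ := key _ _ h
    exact ⟨s, hs, .inl h⟩
  · obtain ⟨s, hs, h⟩ := key _ _ h
    exact ⟨s, hs, .inr h⟩

end DimensionOne

section AxGrothendieck

variable {k : Type} [Field k] [IsAlgClosed k]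

/-- Endomorphisms of affine varieties which are injective on points are surjective on points. -/
lemma exists_comp_eq_of_injective_comp {A : Type} [CommRing A] [Algebra k A]
    [Algebra.FiniteType k A] (γ : A →ₐ[k] A)
    (h : ∀ σ τ : A →ₐ[k] k, σ.comp γ = τ.comp γ → σ = τ) (σ : A →ₐ[k] k) :
    ∃ τ : A →ₐ[k] k, τ.comp γ = σ := by
  obtain ⟨n, f, hf⟩ := Algebra.FiniteType.iff_quotient_mvPolynomial''.mp
    ‹Algebra.FiniteType k A›
  choose p hp using fun i => hf (γ (f (MvPolynomial.X i)))
  let c (σ : A →ₐ[k] k) (i : Fin n) : k := σ (f (MvPolynomial.X i))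
  have haev (σ : A →ₐ[k] k) : MvPolynomial.aeval (c σ) = σ.comp f := by
    apply MvPolynomial.algHom_ext
    intro i
    simp [c]
  have hev (σ : A →ₐ[k] k) (q : MvPolynomial (Fin n) k) : MvPolynomial.eval (c σ) q = σ (f q) := by
    rw [← MvPolynomial.coe_aeval_eq_eval, haev]
    rfl
  have hc (σ : A →ₐ[k] k) : c σ ∈ MvPolynomial.zeroLocus k (RingHom.ker f) := by
    intro q hq
    rw [haev, AlgHom.comp_apply, (RingHom.mem_ker).mp hq, map_zero]
  have hc' : ∀ v ∈ MvPolynomial.zeroLocus k (RingHom.ker f), ∃ σ, c σ = v := by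
    intro v hv
    refine ⟨(Ideal.Quotient.liftₐ (RingHom.ker f) (MvPolynomial.aeval v) hv).comp
      (Ideal.quotientKerAlgEquivOfSurjective hf).symm.toAlgHom, ?_⟩
    ext i
    have : (Ideal.quotientKerAlgEquivOfSurjective hf).symm (f (MvPolynomial.X i)) =
        Ideal.Quotient.mk _ (MvPolynomial.X i) := by
      rw [AlgEquiv.symm_apply_eq]
      rfl
    change Ideal.Quotient.liftₐ (RingHom.ker f) (MvPolynomial.aeval v) hv
      ((Ideal.quotientKerAlgEquivOfSurjective hf).symm (f (MvPolynomial.X i))) = v i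
    rw [this]
    exact MvPolynomial.aeval_X v i
  have hcomp (σ : A →ₐ[k] k) : (fun i => MvPolynomial.eval (c σ) (p i)) = c (σ.comp γ) := by
    ext i
    rw [hev, hp]
    rfl
  have hcinj : Function.Injective c := by
    intro σ τ hστ
    have := haev σ
    rw [hστ, haev τ] at this
    exact (AlgHom.cancel_right hf).mp this.symm
  have key := ax_grothendieck_zeroLocus (RingHom.ker f) p
  obtain ⟨v, hv, hv'⟩ := key (by
      intro v hv
      obtain ⟨τ, rfl⟩ := hc' v hv
      change (fun i => MvPolynomial.eval (c τ) (p i)) ∈ _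
      rw [hcomp]
      exact hc _) (by
      intro v hv w hw hvw
      obtain ⟨τ, rfl⟩ := hc' v hv
      obtain ⟨τ', rfl⟩ := hc' w hw
      change (fun i => MvPolynomial.eval (c τ) (p i)) =
        (fun i => MvPolynomial.eval (c τ') (p i)) at hvw
      rw [hcomp, hcomp] at hvw
      rw [h _ _ (hcinj hvw)]) (hc σ)
  obtain ⟨τ, rfl⟩ := hc' v hv
  refine ⟨τ, hcinj ?_⟩
  rw [← hcomp]
  exact hv'

end AxGrothendieck

section Birational

variable {k : Type} [Field k]

lemma IsBirationalHom.comp {A B C : Type} [CommRing A] [CommRing B] [CommRing C] [IsDomain A]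
    [IsDomain B]
    [Algebra k A] [Algebra k B] [Algebra k C] {β : B →ₐ[k] C} {α : A →ₐ[k] B}
    (hβ : IsBirationalHom β) (hα : IsBirationalHom α) : IsBirationalHom (β.comp α) := by
  refine ⟨hβ.1.comp hα.1, fun c => ?_⟩
  obtain ⟨b₁, b₂, hb, h⟩ := hβ.2 c
  obtain ⟨x₁, x₂, hx, h₁⟩ := hα.2 b₁
  obtain ⟨y₁, y₂, hy, h₂⟩ := hα.2 b₂
  have hy₁ : y₁ ≠ 0 := by
    rintro rfl
    rw [map_zero] at h₂
    rcases mul_eq_zero.mp h₂ with h₀ | h₀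
    · exact hy (hα.1 (by rw [h₀, map_zero]))
    · exact hb h₀
  refine ⟨x₁ * y₂, x₂ * y₁, mul_ne_zero hx hy₁, ?_⟩
  simp only [AlgHom.comp_apply, map_mul, ← h₁, ← h₂, ← h]
  ring

end Birational

section Endomorphism

variable {k A : Type} [Field k] [IsAlgClosed k] [CommRing A] [IsDedekindDomain A] [Algebra k A]
  [Algebra.FiniteType k A]

omit [IsAlgClosed k] [Algebra.FiniteType k A] in
lemma IsBirationalHom.eq_of_comp_eq {γ : A →ₐ[k] A} (hγ : IsBirationalHom γ) {σ τ : A →ₐ[k] k}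
    (h : σ.comp γ = τ.comp γ) : σ = τ := by
  have h' (x : A) : σ (γ x) = τ (γ x) := DFunLike.congr_fun h x
  by_contra hne
  obtain ⟨b, hb⟩ : ∃ b, σ b ≠ τ b := by
    by_contra! hh
    exact hne (AlgHom.ext hh)
  obtain ⟨x, hx, hx'⟩ : ∃ x, σ x = 0 ∧ τ x ≠ 0 :=
    ⟨b - algebraMap k A (σ b), by simp, by simpa [sub_eq_zero] using hb.symm⟩
  obtain ⟨a₁, a₂, ha₂, ha⟩ := hγ.2 x
  have h0 : γ a₂ ≠ 0 := fun h0 => ha₂ (hγ.1 (by rw [h0, map_zero]))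
  have hm : (RingHom.ker (σ.comp γ)).IsMaximal :=
    RingHom.ker_isMaximal_of_surjective _ (fun c => ⟨algebraMap k A c, by simp⟩)
  obtain ⟨s, hs, ⟨c, hc⟩ | ⟨c, hc⟩⟩ := exists_dvd_mul_or_dvd_mul a₁ a₂ (RingHom.ker (σ.comp γ))
  · have h1 : x * γ c = γ s := by
      apply mul_left_cancel₀ h0
      rw [← map_mul, hc, map_mul, ← ha]
      ring
    apply hs
    rw [RingHom.mem_ker, AlgHom.comp_apply, ← h1, map_mul, hx, zero_mul]
  · have h1 : γ c = x * γ s := by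
      apply mul_left_cancel₀ h0
      rw [← map_mul, ← hc, map_mul, ← ha]
      ring
    have h2 : τ (γ s) = 0 := by
      have : τ (γ c) = 0 := by rw [← h', h1, map_mul, hx, zero_mul]
      rw [h1, map_mul] at this
      exact (mul_eq_zero.mp this).resolve_left hx'
    exact hs (by rw [RingHom.mem_ker, AlgHom.comp_apply, h', h2])

lemma IsBirationalHom.surjective {γ : A →ₐ[k] A} (hγ : IsBirationalHom γ) :
    Function.Surjective γ := by
  intro a
  obtain ⟨a₁, a₂, ha₂, ha⟩ := hγ.2 a
  have h0 : γ a₂ ≠ 0 := fun h0 => ha₂ (hγ.1 (by rw [h0, map_zero]))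
  let J : Ideal A := Submodule.comap (LinearMap.mulLeft A a₁) (Ideal.span {a₂})
  have hJ (s : A) : s ∈ J ↔ a₂ ∣ a₁ * s := Ideal.mem_span_singleton
  have hJ1 : J = ⊤ := by
    by_contra hJ'
    obtain ⟨M, hM, hJM⟩ := Ideal.exists_le_maximal J hJ'
    obtain ⟨σ, hσ⟩ := exists_algHom_ker_eq (k := k) M
    obtain ⟨τ, rfl⟩ := exists_comp_eq_of_injective_comp γ (fun _ _ => hγ.eq_of_comp_eq) σ
    obtain ⟨s, hs, h | ⟨c, hc⟩⟩ := exists_dvd_mul_or_dvd_mul a₂ a₁ M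
    · exact hs (hJM ((hJ s).mpr h))
    · have h1 : γ s = a * γ c := by
        apply mul_left_cancel₀ h0
        rw [← map_mul, hc, map_mul, ← ha]
        ring
      have h2 : c ∈ J := (hJ c).mpr ⟨s, hc.symm⟩
      have h3 : τ (γ c) = 0 := (hσ c).mpr (hJM h2)
      apply hs
      rw [← hσ, AlgHom.comp_apply, h1, map_mul, h3, mul_zero]
  obtain ⟨c, hc⟩ := (hJ 1).mp (hJ1 ▸ Submodule.mem_top)
  refine ⟨c, mul_left_cancel₀ h0 ?_⟩
  rw [← map_mul, ← hc, mul_one, ha]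

lemma nonempty_algEquiv_of_isBirationalHom {B : Type} [CommRing B] [IsDomain B] [Algebra k B]
    {α : A →ₐ[k] B} {β : B →ₐ[k] A} (hα : IsBirationalHom α) (hβ : IsBirationalHom β) :
    Nonempty (A ≃ₐ[k] B) :=
  ⟨(AlgEquiv.ofBijective β ⟨hβ.1, fun a => by
    obtain ⟨x, hx⟩ := (hβ.comp hα).surjective a
    exact ⟨α x, hx⟩⟩).symm⟩

end Endomorphism

section PointEvaluation

variable {k B : Type} [Field k] [CommRing B] [Algebra k B]

/-- Evaluation of the second factor of `B ⊗ B` at a point. -/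
noncomputable def evalRight (σ : B →ₐ[k] k) : B ⊗[k] B →ₐ[k] B :=
  Algebra.TensorProduct.productMap (AlgHom.id k B) ((Algebra.ofId k B).comp σ)

/-- Evaluation of the first factor of `B ⊗ B` at a point. -/
noncomputable def evalLeft (σ : B →ₐ[k] k) : B ⊗[k] B →ₐ[k] B :=
  Algebra.TensorProduct.productMap ((Algebra.ofId k B).comp σ) (AlgHom.id k B)

lemma evalRight_tmul (σ : B →ₐ[k] k) (x y : B) : evalRight σ (x ⊗ₜ y) = σ y • x := by
  simp [evalRight, Algebra.smul_def, Algebra.ofId_apply, mul_comm]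

lemma evalLeft_tmul (σ : B →ₐ[k] k) (x y : B) : evalLeft σ (x ⊗ₜ y) = σ x • y := by
  simp [evalLeft, Algebra.smul_def, Algebra.ofId_apply]

lemma apply_evalRight (σ τ : B →ₐ[k] k) (z : B ⊗[k] B) :
    σ (evalRight τ z) = τ (evalLeft σ z) := by
  induction z using TensorProduct.induction_on with
  | zero => simp
  | add x y hx hy => simp only [map_add, hx, hy]
  | tmul x y =>
    rw [evalRight_tmul, evalLeft_tmul, map_smul, map_smul, smul_eq_mul, smul_eq_mul, mul_comm]

variable [IsAlgClosed k] [IsDomain B] [Algebra.FiniteType k B]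

lemma eq_zero_of_forall_point {b : B} (h : ∀ σ : B →ₐ[k] k, σ b = 0) : b = 0 := by
  have : IsJacobsonRing B := isJacobsonRing_of_finiteType (A := k)
  have h1 : (⊥ : Ideal B).jacobson = ⊥ :=
    IsJacobsonRing.out inferInstance (Ideal.isPrime_bot.isRadical)
  rw [← Ideal.mem_bot, ← h1, Ideal.jacobson, Submodule.mem_sInf]
  rintro M ⟨-, hM⟩
  obtain ⟨σ, hσ⟩ := exists_algHom_ker_eq (k := k) M
  exact (hσ b).mp (h σ)

lemma eq_zero_of_forall_evalRight {z : B ⊗[k] B} (h : ∀ σ : B →ₐ[k] k, evalRight σ z = 0) :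
    z = 0 := by
  classical
  let β := Module.Basis.ofVectorSpace k B
  apply (TensorProduct.equivFinsuppOfBasisLeft β).injective
  rw [map_zero]
  ext i
  rw [Finsupp.zero_apply]
  refine eq_zero_of_forall_point (k := k) fun σ => ?_
  have h2 (z : B ⊗[k] B) : σ (TensorProduct.equivFinsuppOfBasisLeft β z i) =
      β.repr (evalRight σ z) i := by
    induction z using TensorProduct.induction_on with
    | zero => simp
    | add x y hx hy => simp only [map_add, Finsupp.add_apply, hx, hy]
    | tmul b c =>
      rw [TensorProduct.equivFinsuppOfBasisLeft_apply_tmul_apply, evalRight_tmul, map_smul,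
        map_smul, Finsupp.smul_apply, smul_eq_mul, smul_eq_mul, mul_comm]
  rw [h2, h, map_zero, Finsupp.zero_apply]

lemma exists_evaluation_notMem_range {z : B ⊗[k] B}
    (hz : z ∉ Set.range (algebraMap k (B ⊗[k] B))) :
    ∃ f : B ⊗[k] B →ₐ[k] B, f z ∉ Set.range (algebraMap k B) := by
  by_contra! h
  obtain ⟨M, hM⟩ := Ideal.exists_maximal B
  obtain ⟨σ₀, -⟩ := exists_algHom_ker_eq (k := k) M
  obtain ⟨c, hc⟩ := h (evalLeft σ₀)
  apply hz
  refine ⟨c, ?_⟩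
  rw [← sub_eq_zero, ← neg_eq_zero, neg_sub]
  refine eq_zero_of_forall_evalRight fun τ => ?_
  obtain ⟨d, hd⟩ := h (evalRight τ)
  have := apply_evalRight σ₀ τ z
  rw [← hc, ← hd, AlgHom.commutes, AlgHom.commutes] at this
  change d = c at this
  rw [map_sub, ← hd, AlgHom.commutes, this]
  exact sub_self _

/-- Nonconstant functions remain nonconstant under a suitable homomorphism. -/
lemma exists_algHom_notMem_range {A : Type} [CommRing A] [Algebra k A]
    (e : A ⊗[k] A ≃ₐ[k] B ⊗[k] B) {a : A} (ha : a ∉ Set.range (algebraMap k A)) :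
    ∃ f : A →ₐ[k] B, f a ∉ Set.range (algebraMap k B) := by
  obtain ⟨f, hf⟩ := exists_evaluation_notMem_range (z := e (a ⊗ₜ 1)) (by
    rintro ⟨c, hc⟩
    apply ha
    refine ⟨c, ?_⟩
    rw [← e.commutes] at hc
    have := congrArg (Algebra.TensorProduct.lmul' k) (e.injective hc)
    rw [AlgHom.commutes] at this
    simpa using this)
  exact ⟨(f.comp e.toAlgHom).comp Algebra.TensorProduct.includeLeft, hf⟩

end PointEvaluation

section Generators

open Polynomial IntermediateField

variable {k : Type} [Field k]

lemma exists_isCoprime_of_adjoin_eq_top {K : Type} [Field K] [Algebra k K] {u : K}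
    (hu : k⟮u⟯ = ⊤) (x : K) :
    ∃ r s : k[X], IsCoprime r s ∧ aeval u s ≠ 0 ∧ x * aeval u s = aeval u r := by
  obtain ⟨r, s, hrs⟩ := (mem_adjoin_simple_iff k x).mp (hu ▸ IntermediateField.mem_top)
  by_cases hs : aeval u s = 0
  · refine ⟨0, 1, isCoprime_zero_left.mpr isUnit_one, by simp, ?_⟩
    rw [hrs, hs]
    simp
  · classical
    let _ : GCDMonoid k[X] := EuclideanDomain.gcdMonoid _
    obtain ⟨r', s', hr, hs', h⟩ := extract_gcd r s
    generalize GCDMonoid.gcd r s = g at hr hs'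
    subst hr hs'
    rw [map_mul] at hs
    have hs₁ := left_ne_zero_of_mul hs
    have hs₂ := right_ne_zero_of_mul hs
    refine ⟨r', s', (gcd_isUnit_iff r' s').mp h, hs₂, ?_⟩
    rw [hrs, map_mul, map_mul]
    field_simp

lemma IsLaurentish.exists_adjoin_eq_top {A : Type} [CommRing A] [IsDomain A] [Algebra k A]
    (h : IsLaurentish k A) : ∃ u : FractionRing A, k⟮u⟯ = ⊤ := by
  obtain ⟨ψ, hψ, -⟩ := h
  let Ψ : FractionRing A →ₐ[k] RatFunc k := IsFractionRing.liftAlgHom (g := ψ) hψ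
  obtain ⟨u, hu⟩ : RatFunc.Luroth.generator Ψ.fieldRange ∈ Ψ.fieldRange :=
    RatFunc.Luroth.generator_mem
  refine ⟨u, ?_⟩
  apply (IntermediateField.map_injective Ψ)
  rw [← AlgHom.fieldRange_eq_map, IntermediateField.adjoin_map, Set.image_singleton]
  conv_rhs => rw [RatFunc.Luroth.eq_adjoin_generator (E := Ψ.fieldRange)]
  rw [← hu]
  rfl

lemma isIntegral_of_leadingCoeff {A K : Type} [CommRing A] [CommRing K] [Algebra k A]
    [Algebra A K] {f : A[X]} {c : k} (hc : c ≠ 0) (hf : f.leadingCoeff = algebraMap k A c) {x : K}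
    (hx : aeval x f = 0) : IsIntegral A x := by
  refine ⟨C (algebraMap k A c⁻¹) * f, monic_C_mul_of_mul_leadingCoeff_eq_one ?_, ?_⟩
  · rw [hf, ← map_mul, inv_mul_cancel₀ hc, map_one]
  · rw [← aeval_def, map_mul, hx, mul_zero]

lemma isIntegral_inv_of_coeff_zero {A K : Type} [CommRing A] [Nontrivial A] [Field K] [Algebra k A]
    [Algebra A K] {f : A[X]} {c : k} (hc : c ≠ 0) (hf : f.coeff 0 = algebraMap k A c) {x : K}
    (hx : aeval x f = 0) (hx0 : x ≠ 0) : IsIntegral A x⁻¹ := by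
  have h0 : f.coeff 0 ≠ 0 := by
    rw [hf, Ne, map_eq_zero_iff _ (algebraMap k A).injective]
    exact hc
  refine isIntegral_of_leadingCoeff (f := f.reverse) hc ?_ ?_
  · rw [reverse_leadingCoeff, trailingCoeff, natTrailingDegree_eq_zero.mpr (.inr h0), hf]
  · let _ := invertibleOfNonzero hx0
    rw [aeval_def] at hx ⊢
    rw [← invOf_eq_inv]
    exact (eval₂_reverse_eq_zero_iff _ _ _).mpr hx

lemma exists_integral_generator [IsAlgClosed k] {A : Type} [CommRing A] [IsDomain A] [Algebra k A]
    [IsIntegrallyClosed A] {u : FractionRing A} (hu : k⟮u⟯ = ⊤) {a : A}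
    (ha : a ∉ Set.range (algebraMap k A)) :
    ∃ t : A, k⟮algebraMap A (FractionRing A) t⟯ = ⊤ := by
  obtain ⟨r, s, hrs, hs, h⟩ := exists_isCoprime_of_adjoin_eq_top hu (algebraMap A _ a)
  let f : A[X] := r.map (algebraMap k A) - C a * s.map (algebraMap k A)
  have hf : aeval u f = 0 := by
    rw [map_sub, map_mul, aeval_map_algebraMap, aeval_map_algebraMap, aeval_C, h, sub_self]
  by_cases hs' : s.degree = 0
  · obtain ⟨c, hc, rfl⟩ : ∃ c : k, c ≠ 0 ∧ C c = s :=
      ⟨s.coeff 0, coeff_ne_zero_of_eq_degree hs', (eq_C_of_degree_eq_zero hs').symm⟩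
    have hr : 0 < r.degree := by
      by_contra! hr
      rw [eq_C_of_degree_le_zero hr, aeval_C, aeval_C] at h
      apply ha
      refine ⟨r.coeff 0 / c, ?_⟩
      apply IsFractionRing.injective A (FractionRing A)
      rw [← IsScalarTower.algebraMap_apply, map_div₀, ← h, mul_div_cancel_right₀]
      rwa [aeval_C] at hs
    have : IsIntegral A u := by
      refine isIntegral_of_leadingCoeff (c := r.leadingCoeff) ?_ ?_ hf
      · rw [Ne, leadingCoeff_eq_zero]
        rintro rfl
        simp at hr
      · rw [leadingCoeff_sub_of_degree_lt, leadingCoeff_map]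
        rw [map_C, ← C_mul, degree_map]
        exact degree_C_le.trans_lt hr
    obtain ⟨t, rfl⟩ := IsIntegrallyClosed.isIntegral_iff.mp this
    exact ⟨t, hu⟩
  · obtain ⟨c, hc⟩ := IsAlgClosed.exists_root s hs'
    have hrc : r.eval c ≠ 0 := by
      intro hr
      obtain ⟨p, q, hpq⟩ := hrs
      have := congrArg (eval c) hpq
      rw [eval_add, eval_mul, eval_mul, hr, hc.eq_zero] at this
      simp at this
    have huc : u - algebraMap k _ c ≠ 0 := by
      intro h0
      apply hs
      rw [sub_eq_zero.mp h0, aeval_algebraMap_apply, coe_aeval_eq_eval, hc.eq_zero, map_zero]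
    have : IsIntegral A (u - algebraMap k _ c)⁻¹ := by
      refine isIntegral_inv_of_coeff_zero (f := f.comp (X + C (algebraMap k A c))) hrc ?_ ?_ huc
      · rw [coeff_zero_eq_eval_zero, eval_comp]
        simp [f, eval_map, eval₂_at_apply, hc.eq_zero]
      · rw [aeval_comp]
        simp [← IsScalarTower.algebraMap_apply, hf]
    obtain ⟨t, ht⟩ := IsIntegrallyClosed.isIntegral_iff.mp this
    refine ⟨t, ?_⟩
    rw [ht, eq_top_iff, ← hu, adjoin_simple_le_iff]
    have h1 := inv_mem (mem_adjoin_simple_self k (u - algebraMap k _ c)⁻¹)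
    rw [inv_inv] at h1
    have h2 := add_mem h1 (IntermediateField.algebraMap_mem _ c)
    rwa [sub_add_cancel] at h2

end Generators

section LineAndPuncturedLine

open Polynomial IntermediateField

variable {k A : Type} [Field k] [CommRing A] [IsDomain A] [Algebra k A]

lemma exists_isUnit_mul_eq {t : A} (ht : k⟮algebraMap A (FractionRing A) t⟯ = ⊤) (x : A) :
    ∃ r s : k[X], IsUnit (aeval t s) ∧ x * aeval t s = aeval t r := by
  obtain ⟨r, s, ⟨p, q, hpq⟩, -, h⟩ := exists_isCoprime_of_adjoin_eq_top ht (algebraMap A _ x)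
  rw [aeval_algebraMap_apply, aeval_algebraMap_apply, ← map_mul] at h
  have h' := IsFractionRing.injective A (FractionRing A) h
  refine ⟨r, s, .of_mul_eq_one (aeval t p * x + aeval t q) ?_, h'⟩
  have := congrArg (aeval t) hpq
  simp only [map_add, map_mul, map_one, ← h'] at this
  rw [← this]
  ring

lemma aeval_injective_of_notMem_range [IsAlgClosed k] {t : A}
    (ht : t ∉ Set.range (algebraMap k A)) : Function.Injective (aeval (R := k) t) := by
  rw [← transcendental_iff_injective,
    ← transcendental_algebraMap_iff (IsFractionRing.injective A (FractionRing A))]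
  apply transcendental_of_notMem_range
  rintro ⟨c, hc⟩
  rw [IsScalarTower.algebraMap_apply k A] at hc
  exact ht ⟨c, IsFractionRing.injective A (FractionRing A) hc⟩

lemma nonempty_algEquiv_polynomial [IsAlgClosed k] {t : A}
    (ht : k⟮algebraMap A (FractionRing A) t⟯ = ⊤) (ht' : t ∉ Set.range (algebraMap k A))
    (h : ∀ c : k, ¬ IsUnit (t - algebraMap k A c)) : Nonempty (A ≃ₐ[k] k[X]) := by
  refine ⟨(AlgEquiv.ofBijective (aeval (R := k) t)
    ⟨aeval_injective_of_notMem_range ht', fun x => ?_⟩).symm⟩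
  obtain ⟨r, s, hs, hx⟩ := exists_isUnit_mul_eq ht x
  have hs0 : s.degree = 0 := by
    by_contra h0
    obtain ⟨c, hc⟩ := IsAlgClosed.exists_root s h0
    obtain ⟨s', rfl⟩ := dvd_iff_isRoot.mpr hc
    apply h c
    rw [map_mul] at hs
    simpa using isUnit_of_mul_isUnit_left hs
  have hc : s.coeff 0 ≠ 0 := coeff_ne_zero_of_eq_degree hs0
  rw [eq_C_of_degree_eq_zero hs0, aeval_C] at hx
  refine ⟨C (s.coeff 0)⁻¹ * r, ?_⟩
  rw [map_mul, ← hx, aeval_C, mul_left_comm, ← map_mul, inv_mul_cancel₀ hc, map_one, mul_one]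

lemma nonempty_algEquiv_laurentPolynomial [IsAlgClosed k] {t : A}
    (ht : k⟮algebraMap A (FractionRing A) t⟯ = ⊤) (ht' : t ∉ Set.range (algebraMap k A))
    (htu : IsUnit t) (h : ∀ c : k, c ≠ 0 → ¬ IsUnit (t - algebraMap k A c)) :
    Nonempty (A ≃ₐ[k] LaurentPolynomial k) := by
  let _ : Algebra k[X] A := (aeval (R := k) t).toAlgebra
  have : IsScalarTower k k[X] A := .of_algebraMap_eq' (aeval t).comp_algebraMap.symm
  have halg (p : k[X]) : algebraMap k[X] A p = aeval t p := rfl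
  have : IsLocalization.Away (X : k[X]) A := by
    refine ⟨?_, ?_, ?_⟩
    · rintro ⟨_, n, rfl⟩
      simpa [halg] using htu.pow n
    · intro x
      obtain ⟨r, s, hs, hx⟩ := exists_isUnit_mul_eq ht x
      have hs0 : s ≠ 0 := by
        rintro rfl
        simp at hs
      obtain ⟨q, hq, hq'⟩ := exists_eq_pow_rootMultiplicity_mul_and_not_dvd s hs0 0
      rw [C_0, sub_zero] at hq hq'
      generalize rootMultiplicity 0 s = n at hq
      subst hq
      have hq0 : q.degree = 0 := by
        by_contra h0
        obtain ⟨c, hc⟩ := IsAlgClosed.exists_root q h0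
        have hdvd := dvd_iff_isRoot.mpr hc
        have hc0 : c ≠ 0 := by
          rintro rfl
          exact hq' (by simpa using hdvd)
        obtain ⟨s', rfl⟩ := hdvd
        apply h c hc0
        rw [map_mul, map_mul] at hs
        simpa using isUnit_of_mul_isUnit_left (isUnit_of_mul_isUnit_right hs)
      have hc : q.coeff 0 ≠ 0 := coeff_ne_zero_of_eq_degree hq0
      rw [eq_C_of_degree_eq_zero hq0, map_mul, aeval_C] at hx
      refine ⟨⟨C (q.coeff 0)⁻¹ * r, ⟨X ^ n, n, rfl⟩⟩, ?_⟩
      simp only [halg]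
      rw [map_mul, ← hx, aeval_C]
      calc _ = x * aeval t (X ^ n) * algebraMap k A (q.coeff 0 * (q.coeff 0)⁻¹) := by
            rw [mul_inv_cancel₀ hc, map_one, mul_one]
        _ = _ := by
            rw [map_mul]
            ring
    · intro p q hpq
      exact ⟨1, by rw [aeval_injective_of_notMem_range ht' hpq]⟩
  have : IsScalarTower k k[X] (LaurentPolynomial k) := .of_algebraMap_eq' <| by
    ext c
    simp [LaurentPolynomial.algebraMap_eq_toLaurent]
  exact ⟨(IsLocalization.algEquiv (.powers (X : k[X])) A (LaurentPolynomial k)).restrictScalars k⟩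

omit [IsDomain A] in
/-- Units of a ring embedded in Laurent polynomials are monomials. -/
lemma exists_mul_X_pow_eq_of_isUnit [IsAlgClosed k] {ψ : A →ₐ[k] RatFunc k}
    (hψ : ∀ b, ∃ (p : k[X]) (n : ℕ), ψ b * RatFunc.X ^ n = algebraMap _ _ p) {x : A}
    (hx : IsUnit x) : ∃ (c : k) (m n : ℕ), c ≠ 0 ∧
      ψ x * RatFunc.X ^ n = algebraMap k[X] (RatFunc k) (C c * X ^ m) := by
  obtain ⟨y, hxy⟩ := hx.exists_right_inv
  obtain ⟨p, n, hp⟩ := hψ x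
  obtain ⟨q, m, hq⟩ := hψ y
  have hpq : p * q = X ^ (n + m) := by
    apply RatFunc.algebraMap_injective k
    rw [map_mul, ← hp, ← hq, mul_mul_mul_comm, ← map_mul, hxy, map_one, one_mul, ← pow_add, map_pow,
      RatFunc.algebraMap_X]
  obtain ⟨i, -, hi⟩ := (dvd_prime_pow prime_X _).mp (Dvd.intro _ hpq)
  obtain ⟨u, hu⟩ := hi.symm
  obtain ⟨c, hc, hc'⟩ := Polynomial.isUnit_iff.mp u.isUnit
  exact ⟨c, i, n, hc.ne_zero, by rw [hp, ← hu, ← hc', mul_comm]⟩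

omit [IsDomain A] in
lemma IsLaurentish.eq_zero_of_isUnit_sub [IsAlgClosed k] (h : IsLaurentish k A) {t : A}
    (ht : t ∉ Set.range (algebraMap k A)) (hu : IsUnit t) {d : k}
    (hd : IsUnit (t - algebraMap k A d)) : d = 0 := by
  obtain ⟨ψ, hψ, hψ'⟩ := h
  obtain ⟨c, m, n, hc, h₁⟩ := exists_mul_X_pow_eq_of_isUnit hψ' hu
  obtain ⟨c', m', n', hc', h₂⟩ := exists_mul_X_pow_eq_of_isUnit hψ' hd
  by_contra hd0
  have hconst : ∀ (x : A) (a : k) (i : ℕ),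
      ψ x * RatFunc.X ^ i = algebraMap k[X] (RatFunc k) (C a * X ^ i) →
      x = algebraMap k A a := by
    intro x a i hx
    apply hψ
    rw [map_mul, map_pow, RatFunc.algebraMap_X] at hx
    rw [mul_right_cancel₀ (pow_ne_zero _ RatFunc.X_ne_zero) hx, AlgHom.commutes,
      IsScalarTower.algebraMap_apply k k[X] (RatFunc k)]
    rfl
  have hmn : m ≠ n := by
    rintro rfl
    exact ht ⟨c, (hconst _ _ _ h₁).symm⟩
  have hmn' : m' ≠ n' := by
    rintro rfl
    exact ht ⟨c' + d, by rw [map_add, ← hconst _ _ _ h₂, sub_add_cancel]⟩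
  have key : C c * X ^ (m + n') - C c' * X ^ (m' + n) = (C d * X ^ (n + n') : k[X]) := by
    apply RatFunc.algebraMap_injective k
    have e1 : (C c * X ^ (m + n') : k[X]) = C c * X ^ m * X ^ n' := by ring
    have e2 : (C c' * X ^ (m' + n) : k[X]) = C c' * X ^ m' * X ^ n := by ring
    rw [e1, e2, map_sub, map_mul _ (C c * X ^ m), map_mul _ (C c' * X ^ m'), ← h₁, ← h₂, map_sub,
      AlgHom.commutes]
    simp only [map_mul, map_pow, RatFunc.algebraMap_X, RatFunc.algebraMap_C,
      RatFunc.algebraMap_eq_C]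
    ring
  have := congrArg (fun p => p.coeff (n + n')) key
  simp only [coeff_sub, coeff_C_mul, coeff_X_pow] at this
  rw [if_neg (by omega), if_neg (by omega)] at this
  simp at this
  exact hd0 this.symm

/-- A normal rational curve inside the ring of Laurent polynomials is the line or the punctured
line. -/
lemma IsLaurentish.nonempty_algEquiv [IsAlgClosed k] [IsIntegrallyClosed A]
    (h : IsLaurentish k A) {a : A} (ha : a ∉ Set.range (algebraMap k A)) :
    Nonempty (A ≃ₐ[k] k[X]) ∨ Nonempty (A ≃ₐ[k] LaurentPolynomial k) := by
  obtain ⟨u, hu⟩ := h.exists_adjoin_eq_top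
  obtain ⟨t, ht⟩ := exists_integral_generator hu ha
  have ht' : t ∉ Set.range (algebraMap k A) := by
    rintro ⟨c, rfl⟩
    obtain ⟨r, s, hs, hx⟩ := exists_isUnit_mul_eq ht a
    rw [aeval_algebraMap_apply, aeval_algebraMap_apply] at hx
    rw [aeval_algebraMap_apply] at hs
    apply ha
    have h0 : aeval c s ≠ 0 := by
      intro h0
      rw [h0, map_zero] at hs
      exact not_isUnit_zero hs
    refine ⟨aeval c r / aeval c s, ?_⟩
    apply mul_right_cancel₀ hs.ne_zero
    rw [hx, ← map_mul, div_mul_cancel₀ _ h0]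
  by_cases hc : ∀ c : k, ¬ IsUnit (t - algebraMap k A c)
  · exact .inl (nonempty_algEquiv_polynomial ht ht' hc)
  · push Not at hc
    obtain ⟨c, hc⟩ := hc
    have hc' : t - algebraMap k A c ∉ Set.range (algebraMap k A) := by
      rintro ⟨d, hd⟩
      exact ht' ⟨d + c, by rw [map_add, hd, sub_add_cancel]⟩
    refine .inr (nonempty_algEquiv_laurentPolynomial (t := t - algebraMap k A c) ?_ hc' hc
      fun d hd hd' => hd (h.eq_zero_of_isUnit_sub hc' hc hd'))
    rw [eq_top_iff, ← ht, adjoin_simple_le_iff]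
    have h1 := add_mem (mem_adjoin_simple_self k
      (algebraMap A (FractionRing A) (t - algebraMap k A c)))
      (IntermediateField.algebraMap_mem _ c)
    rw [map_sub, ← IsScalarTower.algebraMap_apply] at h1 ⊢
    rwa [sub_add_cancel] at h1

end LineAndPuncturedLine

section Assembly

variable {k A B : Type} [Field k] [CommRing A] [CommRing B] [Algebra k A] [Algebra k B]

lemma IsLaurentish.of_injective (h : IsLaurentish k B) {f : A →ₐ[k] B}
    (hf : Function.Injective f) : IsLaurentish k A := by
  obtain ⟨ψ, hψ, hψ'⟩ := h
  exact ⟨ψ.comp f, hψ.comp hf, fun a => hψ' (f a)⟩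

/-- The line and the punctured line do not have isomorphic squares. -/
lemma not_algEquiv_of_algEquiv_laurentPolynomial [IsAlgClosed k]
    (eA : A ≃ₐ[k] LaurentPolynomial k) (eB : B ≃ₐ[k] Polynomial k)
    (e : A ⊗[k] A ≃ₐ[k] B ⊗[k] B) : False := by
  have : IsDomain B := eB.toMulEquiv.isDomain
  have : Algebra.FiniteType k B := .equiv inferInstance eB.symm
  have hT : eA.symm (.T 1) ∉ Set.range (algebraMap k A) := by
    rintro ⟨c, hc⟩
    have h := congrArg LaurentPolynomial.degree (congrArg eA hc)
    rw [AlgEquiv.apply_symm_apply, LaurentPolynomial.degree_T, AlgEquiv.commutes,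
      LaurentPolynomial.algebraMap_apply] at h
    have := h ▸ LaurentPolynomial.degree_C_le (algebraMap k k c)
    exact absurd (WithBot.coe_le_coe.mp this) (by norm_num)
  obtain ⟨f, hf⟩ := exists_algHom_notMem_range e hT
  have hu : IsUnit (eB (f (eA.symm (.T 1)))) :=
    (((LaurentPolynomial.isUnit_T 1).map eA.symm).map f).map eB
  obtain ⟨c, -, hc⟩ := Polynomial.isUnit_iff.mp hu
  exact hf ⟨c, eB.injective (by rw [AlgEquiv.commutes, ← hc]; rfl)⟩

lemma IsLaurentish.nonempty_algEquiv_of_square [IsAlgClosed k] [IsDomain A] [IsDomain B]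
    [Algebra.FiniteType k A] [Algebra.FiniteType k B]
    [IsIntegrallyClosed A] [IsIntegrallyClosed B] (hA : Ring.KrullDimLE 1 A)
    {a : A} (ha : a ∉ Set.range (algebraMap k A)) {b : B} (hb : b ∉ Set.range (algebraMap k B))
    (h : IsLaurentish k B) (e : A ⊗[k] A ≃ₐ[k] B ⊗[k] B) : Nonempty (A ≃ₐ[k] B) := by
  obtain ⟨f, hf⟩ := exists_algHom_notMem_range e ha
  rcases (h.of_injective (injective_of_notMem_range hA f hf)).nonempty_algEquiv ha with
    ⟨⟨eA⟩⟩ | ⟨⟨eA⟩⟩ <;> rcases h.nonempty_algEquiv hb with ⟨⟨eB⟩⟩ | ⟨⟨eB⟩⟩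
  · exact ⟨eA.trans eB.symm⟩
  · exact (not_algEquiv_of_algEquiv_laurentPolynomial eB eA e.symm).elim
  · exact (not_algEquiv_of_algEquiv_laurentPolynomial eA eB e).elim
  · exact ⟨eA.trans eB.symm⟩

end Assembly

/-- **Proposition (curves with isomorphic squares are isomorphic).** Let `A` and `B` be
coordinate rings of smooth complex affine curves: integral domains, finitely generated
`ℂ`-algebras, smooth over `ℂ`, of Krull dimension `1`.  If `A ⊗_ℂ A ≅ B ⊗_ℂ B` as
`ℂ`-algebras, then `A ≅ B` as `ℂ`-algebras. -/
theorem curves_with_iso_squares_are_iso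
    (A B : Type) [CommRing A] [CommRing B] [IsDomain A] [IsDomain B]
    [Algebra ℂ A] [Algebra ℂ B]
    [Algebra.FiniteType ℂ A] [Algebra.FiniteType ℂ B]
    [Algebra.Smooth ℂ A] [Algebra.Smooth ℂ B]
    (hA : ringKrullDim A = 1) (hB : ringKrullDim B = 1)
    (hsq : Nonempty ((A ⊗[ℂ] A) ≃ₐ[ℂ] (B ⊗[ℂ] B))) :
    Nonempty (A ≃ₐ[ℂ] B) := by
  obtain ⟨e⟩ := hsq
  have hA' : Ring.KrullDimLE 1 A := Ring.krullDimLE_iff.mpr hA.le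
  have hB' : Ring.KrullDimLE 1 B := Ring.krullDimLE_iff.mpr hB.le
  have := isIntegrallyClosed_of_smooth ℂ A
  have := isIntegrallyClosed_of_smooth ℂ B
  have := isDedekindDomain_of_smooth ℂ hA'
  obtain ⟨a, ha⟩ := exists_notMem_range (k := ℂ) hA
  obtain ⟨b, hb⟩ := exists_notMem_range (k := ℂ) hB
  have hcA : IsCurveField ℂ (FractionRing A) := isCurveField_fractionRing hA'
  have hcB : IsCurveField ℂ (FractionRing B) := isCurveField_fractionRing hB'
  rcases exists_isBirationalHom_or_isLaurentish hcA hcB hb e with ⟨α, hα⟩ | h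
  · rcases exists_isBirationalHom_or_isLaurentish hcB hcA ha e.symm with ⟨β, hβ⟩ | h
    · exact nonempty_algEquiv_of_isBirationalHom hα hβ
    · exact (h.nonempty_algEquiv_of_square hB' hb ha e.symm).map AlgEquiv.symm
  · exact h.nonempty_algEquiv_of_square hA' ha hb e
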